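/- arXiv:2411.08151 — 2 statements merged into one kernel-verified Lean document; each statement's English description precedes it below -/
import Mathlib

section
/- For every pair of constants a, b > 0 there exist constants c > 0 and c₀ such that the following holds. Let G be an n-vertex directed unweighted graph, P a set of p demand pairs, and π(·,·) a consistent tiebreaking scheme for (G,P) such that every edge of G lies on some path of π(P). Let d = ⌈|E(G)|/n⌉ and suppose d ≥ c₀. If S ⊆ V(G) satisfies a·d ≤ |S| ≤ b·d and deg_G(v) ≥ a·d for every v ∈ S, then the number of demand pairs (s,t) ∈ P for which π(s,t) contains a vertex of S is at least c·d². -/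
open Finset

/-- A walk in a directed edge set `F`, given as the list of visited vertices. -/
def IsWalkOn {V : Type} (F : Finset (V × V)) (s t : V) (l : List V) : Prop :=
  l.Chain' (fun a b => (a, b) ∈ F) ∧ l.head? = some s ∧ l.getLast? = some t

def ReachableOn {V : Type} (F : Finset (V × V)) (s t : V) : Prop :=
  ∃ l, IsWalkOn F s t l

/-- A directed weighted graph: a finite set of directed edges together with weights. -/
structure WDigraph (V : Type) where
  Edge : Finset (V × V)
  w : V × V → ℝ

namespace WDigraph

variable {V : Type}

/-- Total weight of a walk (sum of weights of consecutive pairs). -/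
def walkWeight (G : WDigraph V) (l : List V) : ℝ :=
  ((l.zip l.tail).map G.w).sum

/-- Distance from `s` to `t` using only edges of `F`, with weights of `G`. -/
noncomputable def distOn (G : WDigraph V) (F : Finset (V × V)) (s t : V) : ℝ :=
  sInf {x | ∃ l, IsWalkOn F s t l ∧ G.walkWeight l = x}

def IsWalk (G : WDigraph V) (s t : V) (l : List V) : Prop :=
  IsWalkOn G.Edge s t l

def Reachable (G : WDigraph V) (s t : V) : Prop :=
  ReachableOn G.Edge s t

noncomputable def dist (G : WDigraph V) (s t : V) : ℝ :=
  G.distOn G.Edge s t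

/-- All edge weights equal to `1`. -/
def Unweighted (G : WDigraph V) : Prop := ∀ e ∈ G.Edge, G.w e = 1

/-- All edge weights positive. -/
def PosWeights (G : WDigraph V) : Prop := ∀ e ∈ G.Edge, 0 < G.w e

/-- `F` is (the edge set of) an exact distance preserver of `(G, P)`. -/
def IsExactPreserver (G : WDigraph V) (F : Finset (V × V)) (P : Finset (V × V)) : Prop :=
  F ⊆ G.Edge ∧ ∀ q ∈ P, ReachableOn F q.1 q.2 ∧ G.distOn F q.1 q.2 = G.dist q.1 q.2

/-- Total (in plus out) degree of a vertex. -/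
def degree [DecidableEq V] (G : WDigraph V) (v : V) : ℕ :=
  (G.Edge.filter fun e => e.1 = v ∨ e.2 = v).card

end WDigraph
/-- The list of (directed) edges of a path given by its vertex list. -/
def pathEdges {V : Type} (l : List V) : List (V × V) := l.zip l.tail

/-- A tiebreaking scheme: a fixed shortest path (a simple walk achieving the distance)
for each demand pair of `P`. -/
structure TBScheme {V : Type} (G : WDigraph V) (P : Finset (V × V)) where
  path : V × V → List V
  walk : ∀ q ∈ P, G.IsWalk q.1 q.2 (path q)
  nodup : ∀ q ∈ P, (path q).Nodup
  shortest : ∀ q ∈ P, G.walkWeight (path q) = G.dist q.1 q.2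

/-- `x` strictly precedes `y` on the list `l`. -/
def Precedes {V : Type} (l : List V) (x y : V) : Prop :=
  ∃ i j : Fin l.length, i < j ∧ l.get i = x ∧ l.get j = y

/-- The segment of `l` from (the first occurrence of) `x` to (the last occurrence of) `y`. -/
def seg {V : Type} [DecidableEq V] (l : List V) (x y : V) : List V :=
  ((l.dropWhile fun a => decide (a ≠ x)).reverse.dropWhile fun a => decide (a ≠ y)).reverse

/-- Consistency: whenever `x` precedes `y` on two paths of the scheme,
the corresponding subpaths from `x` to `y` coincide. -/
def TBScheme.Consistent {V : Type} [DecidableEq V] {G : WDigraph V} {P : Finset (V × V)}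
    (S : TBScheme G P) : Prop :=
  ∀ q₁ ∈ P, ∀ q₂ ∈ P, ∀ x y : V,
    Precedes (S.path q₁) x y → Precedes (S.path q₂) x y →
      seg (S.path q₁) x y = seg (S.path q₂) x y

/-- The paths of the scheme are pairwise edge-disjoint. -/
def TBScheme.EdgeDisjoint {V : Type} {G : WDigraph V} {P : Finset (V × V)}
    (S : TBScheme G P) : Prop :=
  ∀ q₁ ∈ P, ∀ q₂ ∈ P, S.path q₁ ≠ S.path q₂ →
    ∀ e ∈ pathEdges (S.path q₁), e ∉ pathEdges (S.path q₂)

/-- Ceiling division of naturals: `⌈a / b⌉`. -/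
def natCeilDiv (a b : ℕ) : ℕ := (a + b - 1) / b

/-- `x` comes before `y` in a splitting of `l`, with `m` the part strictly in between. -/
def SplitsAt {V : Type} (l : List V) (x : V) (m : List V) (y : V) : Prop :=
  ∃ l₁ l₂, l = l₁ ++ x :: (m ++ y :: l₂)

theorem SplitsAt.precedes {V : Type} {l m : List V} {x y : V} (h : SplitsAt l x m y) :
    Precedes l x y := by
  obtain ⟨l₁, l₂, rfl⟩ := h
  refine ⟨⟨l₁.length, by simp⟩, ⟨l₁.length + (m.length + 1), by simp⟩, ?_, ?_, ?_⟩
  · simp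
  · simp
  · simp [List.getElem_append_right]

theorem dropWhile_ne_append_cons {V : Type} [DecidableEq V] {l₁ r : List V} {x : V}
    (h : x ∉ l₁) : (l₁ ++ x :: r).dropWhile (fun a => decide (a ≠ x)) = x :: r := by
  induction l₁ with
  | nil => simp
  | cons a t ih =>
    simp only [List.mem_cons, not_or] at h
    have := ih h.2
    simp_all [Ne.symm h.1]

theorem SplitsAt.seg_eq {V : Type} [DecidableEq V] {l m : List V} {x y : V}
    (h : SplitsAt l x m y) (hl : l.Nodup) : seg l x y = x :: (m ++ [y]) := by
  obtain ⟨l₁, l₂, rfl⟩ := h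
  have hx : x ∉ l₁ := fun h' => (List.disjoint_of_nodup_append hl) h' (by simp)
  have hy : y ∉ l₂.reverse := by
    have : (y :: l₂).Nodup := hl.sublist
      (((List.sublist_append_right m _).trans (List.sublist_cons_self x _)).trans
        (List.sublist_append_right l₁ _))
    simpa using (List.nodup_cons.1 this).1
  rw [seg, dropWhile_ne_append_cons hx]
  have : (x :: (m ++ y :: l₂)).reverse = l₂.reverse ++ y :: (x :: m).reverse := by simp
  rw [this, dropWhile_ne_append_cons hy]
  simp

theorem exists_splitsAt_or {V : Type} {l : List V} {x y : V} (hx : x ∈ l) (hy : y ∈ l)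
    (hxy : x ≠ y) : (∃ m, SplitsAt l x m y) ∨ ∃ m, SplitsAt l y m x := by
  obtain ⟨l₁, l₂, rfl⟩ := List.append_of_mem hx
  simp only [List.mem_append, List.mem_cons] at hy
  rcases hy with hy | rfl | hy
  · obtain ⟨u, v, rfl⟩ := List.append_of_mem hy
    exact Or.inr ⟨v, u, l₂, by simp⟩
  · exact absurd rfl hxy
  · obtain ⟨u, v, rfl⟩ := List.append_of_mem hy
    exact Or.inl ⟨u, l₁, v, rfl⟩

theorem exists_append_of_mem_pathEdges {V : Type} {l : List V} {x z : V}
    (h : (x, z) ∈ pathEdges l) : ∃ l₁ l₂, l = l₁ ++ x :: z :: l₂ := by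
  induction l with
  | nil => simp [pathEdges] at h
  | cons a t ih =>
    cases t with
    | nil => simp [pathEdges] at h
    | cons b t =>
      simp only [pathEdges, List.tail_cons, List.zip_cons_cons, List.mem_cons] at h ih
      rcases h with h | h
      · obtain ⟨rfl, rfl⟩ := Prod.mk.inj h
        exact ⟨[], t, rfl⟩
      · obtain ⟨l₁, l₂, h⟩ := ih h
        exact ⟨a :: l₁, l₂, by rw [h]; rfl⟩

theorem List.Nodup.append_cons_inj {V : Type} {l₁ r₁ l₂ r₂ : List V} {x : V}
    (hl : (l₁ ++ x :: r₁).Nodup) (h : l₁ ++ x :: r₁ = l₂ ++ x :: r₂) : l₁ = l₂ ∧ r₁ = r₂ := by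
  have h₁ : x ∉ l₁ := fun h' => (List.disjoint_of_nodup_append hl) h' (by simp)
  have h₂ : x ∉ l₂ := fun h' => (List.disjoint_of_nodup_append (h ▸ hl)) h' (by simp)
  induction l₁ generalizing l₂ with
  | nil => cases l₂ <;> simp_all
  | cons a t ih =>
    cases l₂ with
    | nil => exact absurd (by simp [(List.cons.inj h).1]) h₁
    | cons b t₂ =>
      simp only [List.cons_append, List.cons.injEq] at h
      simp only [List.mem_cons, not_or] at h₁ h₂
      obtain ⟨rfl, h⟩ := h
      obtain ⟨h₃, h₄⟩ := ih (List.nodup_cons.1 hl).2 h h₁.2 h₂.2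
      exact ⟨by rw [h₃], h₄⟩

theorem pathEdges_eq_of_fst_eq {V : Type} {l : List V} (hl : l.Nodup) {e e' : V × V}
    (he : e ∈ pathEdges l) (he' : e' ∈ pathEdges l) (h : e.1 = e'.1) : e = e' := by
  obtain ⟨x, z⟩ := e
  obtain ⟨x', z'⟩ := e'
  obtain rfl : x = x' := h
  obtain ⟨l₁, l₂, rfl⟩ := exists_append_of_mem_pathEdges he
  obtain ⟨l₁', l₂', h'⟩ := exists_append_of_mem_pathEdges he'
  have := (hl.append_cons_inj h').2
  simp_all

theorem pathEdges_eq_of_snd_eq {V : Type} {l : List V} (hl : l.Nodup) {e e' : V × V}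
    (he : e ∈ pathEdges l) (he' : e' ∈ pathEdges l) (h : e.2 = e'.2) : e = e' := by
  obtain ⟨z, x⟩ := e
  obtain ⟨z', x'⟩ := e'
  obtain rfl : x = x' := h
  obtain ⟨l₁, l₂, rfl⟩ := exists_append_of_mem_pathEdges he
  obtain ⟨l₁', l₂', h'⟩ := exists_append_of_mem_pathEdges he'
  rw [List.append_cons, List.append_cons l₁'] at h'
  rw [List.append_cons] at hl
  have := congrArg List.getLast? (hl.append_cons_inj h').1
  simpa using this

theorem SplitsAt.head?_eq {V : Type} {l m : List V} {x y z : V} (h : SplitsAt l x m y)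
    (hl : l.Nodup) (he : (x, z) ∈ pathEdges l) : (m ++ [y]).head? = some z := by
  obtain ⟨l₁, l₂, rfl⟩ := h
  obtain ⟨l₁', l₂', h'⟩ := exists_append_of_mem_pathEdges he
  have := (hl.append_cons_inj h').2
  cases m <;> simp_all

theorem SplitsAt.getLast?_eq {V : Type} {l m : List V} {x y z : V} (h : SplitsAt l x m y)
    (hl : l.Nodup) (he : (z, y) ∈ pathEdges l) : (x :: m).getLast? = some z := by
  obtain ⟨l₁, l₂, rfl⟩ := h
  obtain ⟨l₁', l₂', h'⟩ := exists_append_of_mem_pathEdges he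
  have e₁ : l₁ ++ x :: (m ++ y :: l₂) = (l₁ ++ x :: m) ++ y :: l₂ := by simp
  rw [List.append_cons l₁', e₁] at h'
  rw [e₁] at hl
  have := congrArg List.getLast? (hl.append_cons_inj h').1
  simpa [List.getLast?_append] using this

theorem TBScheme.Consistent.between_eq {V : Type} [DecidableEq V] {G : WDigraph V}
    {P : Finset (V × V)} {S : TBScheme G P} (hS : S.Consistent) {q₁ q₂ : V × V} (h₁ : q₁ ∈ P)
    (h₂ : q₂ ∈ P) {x y : V} {m₁ m₂ : List V} (hm₁ : SplitsAt (S.path q₁) x m₁ y)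
    (hm₂ : SplitsAt (S.path q₂) x m₂ y) : m₁ = m₂ := by
  have := hS q₁ h₁ q₂ h₂ x y hm₁.precedes hm₂.precedes
  rw [hm₁.seg_eq (S.nodup _ h₁), hm₂.seg_eq (S.nodup _ h₂)] at this
  simpa using this

/-- A double counting bound: the elements of `X` are coloured by `f` with colours in `Q` and
labelled by `g` with labels in `T`; distinct elements of the same colour are comparable under `R`,
and a comparable pair of the same colour is determined by its labels. -/
theorem sq_card_le_card_mul_of_labels {α β V : Type} [DecidableEq α] [DecidableEq β]
    [DecidableEq V] (X : Finset α) (Q : Finset β) (T : Finset V) (f : α → β) (g : α → V)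
    (R : α → α → Prop) (hf : ∀ e ∈ X, f e ∈ Q) (hg : ∀ e ∈ X, g e ∈ T)
    (hR : ∀ e ∈ X, ∀ e' ∈ X, f e = f e' → e ≠ e' → R e e' ∨ R e' e)
    (hinj : ∀ e₁ ∈ X, ∀ e₁' ∈ X, ∀ e₂ ∈ X, ∀ e₂' ∈ X, f e₁ = f e₁' → f e₂ = f e₂' →
      R e₁ e₁' → R e₂ e₂' → g e₁ = g e₂ → g e₁' = g e₂' → e₁ = e₂ ∧ e₁' = e₂') :
    X.card ^ 2 ≤ Q.card * (X.card + 2 * T.card ^ 2) := by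
  classical
  set A := (X ×ˢ X).filter fun p => f p.1 = f p.2 with hA
  set B := A.filter fun p => R p.1 p.2 with hB
  have hBT : B.card ≤ T.card ^ 2 := by
    rw [sq, ← card_product]
    apply card_le_card_of_injOn (fun p => (g p.1, g p.2))
    · intro p hp
      simp only [hB, hA, coe_filter, mem_filter, mem_product, Set.mem_ofPred_eq] at hp
      simp [hg _ hp.1.1.1, hg _ hp.1.1.2]
    · intro p hp p' hp' h
      simp only [hB, hA, coe_filter, mem_filter, mem_product, Set.mem_ofPred_eq] at hp hp'
      simp only [Prod.mk.injEq] at h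
      exact Prod.ext_iff.2 (hinj _ hp.1.1.1 _ hp.1.1.2 _ hp'.1.1.1 _ hp'.1.1.2 hp.1.2 hp'.1.2
        hp.2 hp'.2 h.1 h.2)
  have hsub : A ⊆ X.diag ∪ (B ∪ B.image Prod.swap) := by
    rintro ⟨e, e'⟩ hp
    simp only [hA, mem_filter, mem_product] at hp
    by_cases hee : e = e'
    · simp [hee, hp.1.2]
    · rcases hR e hp.1.1 e' hp.1.2 hp.2 hee with h | h
      · simp [hB, hA, hp, h]
      · simp [hB, hA, hp, h]
  have hAcard : A.card ≤ X.card + 2 * T.card ^ 2 := by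
    have h₁ := card_le_card hsub
    have h₂ := card_union_le X.diag (B ∪ B.image Prod.swap)
    have h₃ := card_union_le B (B.image Prod.swap)
    have h₄ : (B.image Prod.swap).card ≤ B.card := card_image_le
    rw [diag_card] at h₂
    omega
  have hsum : A.card = ∑ q ∈ Q, (X.filter fun e => f e = q).card ^ 2 := by
    rw [card_eq_sum_card_fiberwise (f := fun p => f p.1) (t := Q)]
    · refine sum_congr rfl fun q _ => ?_
      rw [sq, ← card_product]
      congr 1
      ext ⟨e, e'⟩
      simp only [hA, mem_filter, mem_product]
      constructor
      · rintro ⟨⟨⟨h₁, h₂⟩, h₃⟩, rfl⟩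
        exact ⟨⟨h₁, rfl⟩, h₂, h₃.symm⟩
      · rintro ⟨⟨h₁, rfl⟩, h₂, h₃⟩
        exact ⟨⟨⟨h₁, h₂⟩, h₃.symm⟩, rfl⟩
    · intro p hp
      simp only [hA, coe_filter, mem_product, Set.mem_ofPred_eq] at hp
      exact hf _ hp.1.1
  have hX : X.card = ∑ q ∈ Q, (X.filter fun e => f e = q).card :=
    card_eq_sum_card_fiberwise hf
  calc X.card ^ 2 = (∑ q ∈ Q, (X.filter fun e => f e = q).card) ^ 2 := by rw [← hX]
    _ ≤ Q.card * ∑ q ∈ Q, (X.filter fun e => f e = q).card ^ 2 := sq_sum_le_card_mul_sum_sq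
    _ ≤ _ := by rw [← hsum]; exact Nat.mul_le_mul_left _ hAcard

theorem mem_of_mem_pathEdges {V : Type} {l : List V} {e : V × V} (h : e ∈ pathEdges l) :
    e.1 ∈ l ∧ e.2 ∈ l :=
  ⟨(List.of_mem_zip h).1, List.mem_of_mem_tail (List.of_mem_zip h).2⟩

/-- The bound on paths meeting `T` in terms of the edges with an endpoint `g e` in `T`, where the
edges of a path are determined by these endpoints. -/
theorem TBScheme.sq_card_edges_le {V : Type} [DecidableEq V] {G : WDigraph V}
    {P : Finset (V × V)} (S : TBScheme G P)
    (hE : ∀ e ∈ G.Edge, ∃ q ∈ P, e ∈ pathEdges (S.path q)) (T : Finset V) (g : V × V → V)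
    (hmem : ∀ q ∈ P, ∀ e ∈ pathEdges (S.path q), g e ∈ S.path q)
    (hinj : ∀ q ∈ P, ∀ e ∈ pathEdges (S.path q), ∀ e' ∈ pathEdges (S.path q),
      g e = g e' → e = e')
    (hsplit : ∀ q₁ ∈ P, ∀ q₂ ∈ P, ∀ e₁ ∈ pathEdges (S.path q₁), ∀ e₁' ∈ pathEdges (S.path q₁),
      ∀ e₂ ∈ pathEdges (S.path q₂), ∀ e₂' ∈ pathEdges (S.path q₂), ∀ m₁ m₂,
      SplitsAt (S.path q₁) (g e₁) m₁ (g e₁') → SplitsAt (S.path q₂) (g e₂) m₂ (g e₂') →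
      g e₁ = g e₂ → g e₁' = g e₂' → e₁ = e₂ ∨ e₁' = e₂') :
    (G.Edge.filter fun e => g e ∈ T).card ^ 2 ≤
      (P.filter fun q => ((S.path q).toFinset ∩ T).Nonempty).card *
        ((G.Edge.filter fun e => g e ∈ T).card + 2 * T.card ^ 2) := by
  classical
  choose! f hfP hf using hE
  refine sq_card_le_card_mul_of_labels _ _ T f g
    (fun e e' => ∃ m, SplitsAt (S.path (f e)) (g e) m (g e')) ?_ ?_ ?_ ?_
  · intro e he
    rw [mem_filter] at he ⊢
    exact ⟨hfP e he.1, g e, by simpa using ⟨hmem _ (hfP e he.1) _ (hf e he.1), he.2⟩⟩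
  · intro e he
    exact (mem_filter.1 he).2
  · intro e he e' he' hff hne
    have he := (mem_filter.1 he).1
    have he' := (mem_filter.1 he').1
    have h := hf e' he'
    rw [← hff] at h ⊢
    exact exists_splitsAt_or (hmem _ (hfP e he) _ (hf e he)) (hmem _ (hfP e he) _ h)
      fun h' => hne (hinj _ (hfP e he) _ (hf e he) _ h h')
  · rintro e₁ he₁ e₁' he₁' e₂ he₂ e₂' he₂' h₁ h₂ ⟨m₁, hm₁⟩ ⟨m₂, hm₂⟩ hg hg'
    have he₁ := (mem_filter.1 he₁).1
    have he₂ := (mem_filter.1 he₂).1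
    have k₁ := hf e₁' (mem_filter.1 he₁').1
    have k₂ := hf e₂' (mem_filter.1 he₂').1
    rw [← h₁] at k₁
    rw [← h₂] at k₂
    rcases hsplit _ (hfP e₁ he₁) _ (hfP e₂ he₂) _ (hf e₁ he₁) _ k₁ _ (hf e₂ he₂) _ k₂ _ _
      hm₁ hm₂ hg hg' with h | h
    · subst h
      exact ⟨rfl, hinj _ (hfP _ he₁) _ k₁ _ k₂ hg'⟩
    · subst h
      have hff : f e₁ = f e₂ := h₁.trans h₂.symm
      exact ⟨hinj _ (hfP _ he₁) _ (hf e₁ he₁) _ (hff ▸ hf e₂ he₂) hg, rfl⟩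

theorem TBScheme.Consistent.sq_card_out_edges_le {V : Type} [DecidableEq V] {G : WDigraph V}
    {P : Finset (V × V)} {S : TBScheme G P} (hS : S.Consistent)
    (hE : ∀ e ∈ G.Edge, ∃ q ∈ P, e ∈ pathEdges (S.path q)) (T : Finset V) :
    (G.Edge.filter fun e => e.1 ∈ T).card ^ 2 ≤
      (P.filter fun q => ((S.path q).toFinset ∩ T).Nonempty).card *
        ((G.Edge.filter fun e => e.1 ∈ T).card + 2 * T.card ^ 2) := by
  refine S.sq_card_edges_le hE T Prod.fst (fun q _ e he => (mem_of_mem_pathEdges he).1)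
    (fun q hq e he e' he' h => pathEdges_eq_of_fst_eq (S.nodup q hq) he he' h) ?_
  rintro q₁ hq₁ q₂ hq₂ ⟨x, z₁⟩ he₁ ⟨y, z₁'⟩ - ⟨x₂, z₂⟩ he₂ ⟨y₂, z₂'⟩ - m₁ m₂ hm₁ hm₂ hx hy
  dsimp only at *
  subst hx hy
  obtain rfl := hS.between_eq hq₁ hq₂ hm₁ hm₂
  have h := (hm₁.head?_eq (S.nodup _ hq₁) he₁).symm.trans (hm₂.head?_eq (S.nodup _ hq₂) he₂)
  exact Or.inl (by rw [Option.some.inj h])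

theorem TBScheme.Consistent.sq_card_in_edges_le {V : Type} [DecidableEq V] {G : WDigraph V}
    {P : Finset (V × V)} {S : TBScheme G P} (hS : S.Consistent)
    (hE : ∀ e ∈ G.Edge, ∃ q ∈ P, e ∈ pathEdges (S.path q)) (T : Finset V) :
    (G.Edge.filter fun e => e.2 ∈ T).card ^ 2 ≤
      (P.filter fun q => ((S.path q).toFinset ∩ T).Nonempty).card *
        ((G.Edge.filter fun e => e.2 ∈ T).card + 2 * T.card ^ 2) := by
  refine S.sq_card_edges_le hE T Prod.snd (fun q _ e he => (mem_of_mem_pathEdges he).2)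
    (fun q hq e he e' he' h => pathEdges_eq_of_snd_eq (S.nodup q hq) he he' h) ?_
  rintro q₁ hq₁ q₂ hq₂ ⟨z₁, x⟩ - ⟨z₁', y⟩ he₁ ⟨z₂, x₂⟩ - ⟨z₂', y₂⟩ he₂ m₁ m₂ hm₁ hm₂ hx hy
  dsimp only at *
  subst hx hy
  obtain rfl := hS.between_eq hq₁ hq₂ hm₁ hm₂
  have h := (hm₁.getLast?_eq (S.nodup _ hq₁) he₁).symm.trans
    (hm₂.getLast?_eq (S.nodup _ hq₂) he₂)
  exact Or.inr (by rw [Option.some.inj h])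

theorem WDigraph.sum_degree_le {V : Type} [DecidableEq V] (G : WDigraph V) (T : Finset V) :
    ∑ v ∈ T, G.degree v ≤
      (G.Edge.filter fun e => e.1 ∈ T).card + (G.Edge.filter fun e => e.2 ∈ T).card := by
  have key : ∀ g : V × V → V, (G.Edge.filter fun e => g e ∈ T).card =
      ∑ v ∈ T, (G.Edge.filter fun e => g e = v).card := by
    intro g
    have hmaps : Set.MapsTo g (G.Edge.filter fun e => g e ∈ T) T :=
      fun e he => (mem_filter.1 he).2
    rw [card_eq_sum_card_fiberwise hmaps]
    refine sum_congr rfl fun v hv => ?_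
    rw [filter_filter]
    congr 1
    ext e
    simp only [mem_filter]
    constructor
    · rintro ⟨h, -, h'⟩
      exact ⟨h, h'⟩
    · rintro ⟨h, rfl⟩
      exact ⟨h, hv, rfl⟩
  rw [key Prod.fst, key Prod.snd, ← sum_add_distrib]
  refine sum_le_sum fun v _ => ?_
  rw [WDigraph.degree, filter_or]
  exact card_union_le _ _

theorem mul_le_of_sq_le_mul_add {A β D M k t : ℝ} (hA : 0 < A) (hβ : 0 < β) (hD : 0 ≤ D)
    (hk : 0 ≤ k) (hM : A * D ≤ M) (ht : t ≤ β * D) (h : M ^ 2 ≤ k * (M + t)) :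
    A ^ 2 / (A + β) * D ≤ k := by
  have hAβ : 0 < A + β := by positivity
  rcases hD.eq_or_lt with rfl | hD
  · simpa using hk
  have hM₀ : 0 < M := (mul_pos hA hD).trans_le hM
  by_contra! hlt
  rw [div_mul_eq_mul_div, lt_div_iff₀ hAβ] at hlt
  have h₁ : M ^ 2 ≤ k * (M + β * D) := h.trans (by gcongr)
  have h₂ : M ^ 2 * (A + β) ≤ k * (A + β) * (M + β * D) := by
    nlinarith [mul_le_mul_of_nonneg_right h₁ hAβ.le]
  have h₃ : k * (A + β) * (M + β * D) < A ^ 2 * D * (M + β * D) := by gcongr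
  have h₄ : A * (A * D) * M ≤ A * M * M := by gcongr
  have h₅ : β * ((A * D) * (A * D)) ≤ β * (M * M) := by gcongr
  nlinarith

/-- many demand paths pass through a dense set `S`:
at least `c·d²` paths of the scheme contain a vertex of `S`. -/
theorem many_paths_through_cluster (a b : ℝ) (ha : 0 < a) (hb : 0 < b) :
    ∃ c c₀ : ℝ, 0 < c ∧
      ∀ (V : Type) [DecidableEq V] [Fintype V] (G : WDigraph V), G.Unweighted →
      ∀ (P : Finset (V × V)) (S : TBScheme G P), S.Consistent →
        (∀ e ∈ G.Edge, ∃ q ∈ P, e ∈ pathEdges (S.path q)) →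
        ∀ n d : ℕ, n = Fintype.card V → d = natCeilDiv G.Edge.card n → c₀ ≤ (d : ℝ) →
        ∀ T : Finset V, a * (d : ℝ) ≤ (T.card : ℝ) → (T.card : ℝ) ≤ b * (d : ℝ) →
          (∀ v ∈ T, a * (d : ℝ) ≤ (G.degree v : ℝ)) →
          c * (d : ℝ) ^ 2 ≤
            ((P.filter fun q => ((S.path q).toFinset ∩ T).Nonempty).card : ℝ) := by
  refine ⟨(a ^ 2 / 2) ^ 2 / (a ^ 2 / 2 + 2 * b ^ 2), 0, by positivity, ?_⟩
  intro V _ _ G _ P S hS hE n d _ _ _ T haT hbT hdeg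
  have hsum : a ^ 2 * (d : ℝ) ^ 2 ≤ ((G.Edge.filter fun e => e.1 ∈ T).card : ℝ) +
      ((G.Edge.filter fun e => e.2 ∈ T).card : ℝ) := by
    calc a ^ 2 * (d : ℝ) ^ 2 = (a * d) * (a * d) := by ring
      _ ≤ (T.card : ℝ) * (a * d) := by gcongr
      _ = ∑ v ∈ T, a * (d : ℝ) := by simp
      _ ≤ ∑ v ∈ T, (G.degree v : ℝ) := sum_le_sum hdeg
      _ ≤ _ := by exact_mod_cast G.sum_degree_le T
  have hT : 2 * (T.card : ℝ) ^ 2 ≤ 2 * b ^ 2 * (d : ℝ) ^ 2 := by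
    calc 2 * (T.card : ℝ) ^ 2 ≤ 2 * (b * d) ^ 2 := by gcongr
      _ = _ := by ring
  have hfinish : ∀ M : ℕ, a ^ 2 / 2 * (d : ℝ) ^ 2 ≤ M →
      M ^ 2 ≤ (P.filter fun q => ((S.path q).toFinset ∩ T).Nonempty).card *
        (M + 2 * T.card ^ 2) →
      (a ^ 2 / 2) ^ 2 / (a ^ 2 / 2 + 2 * b ^ 2) * (d : ℝ) ^ 2 ≤
        ((P.filter fun q => ((S.path q).toFinset ∩ T).Nonempty).card : ℝ) := fun M hM h =>
    mul_le_of_sq_le_mul_add (by positivity) (by positivity) (by positivity) (by positivity)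
      hM hT (by exact_mod_cast h)
  rcases le_total (a ^ 2 / 2 * (d : ℝ) ^ 2) ((G.Edge.filter fun e => e.1 ∈ T).card : ℝ) with h | h
  · exact hfinish _ h (hS.sq_card_out_edges_le hE T)
  · exact hfinish _ (by linarith) (hS.sq_card_in_edges_le hE T)
end

section
/- There is a universal constant C ≥ 1 such that the following holds. Let G be an n-vertex directed unweighted graph and P a set of p demand pairs in the transitive closure of G, and suppose there is a real L ≥ 1 such that L/2 ≤ dist_G(s,t) ≤ 2L for every (s,t) ∈ P. Then for every real φ with φ ≥ 10p/n^{1/2}, there exists an exact distance preserver H of (G,P) with |E(H)| ≤ C·(log(n+1))^C·( L^{1/2}·p²/φ^{3/2} + n·p/φ² + n·φ ). -/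
open Finset

/-- A finite family of paths through a finite vertex set, recorded by incidences and positions:
every vertex lies on exactly `k` paths, positions range over `[1, M]`, two paths meet their common
vertices in opposite orders, and going along two paths is never shorter than along a third one. -/
structure PathSystem (ι V : Type) (k M : ℕ) where
  on : V → Finset ι
  pos : ι → V → ℕ
  card_on : ∀ v, #(on v) = k
  pos_pos : ∀ {i v}, i ∈ on v → 1 ≤ pos i v
  pos_le : ∀ {i v}, i ∈ on v → pos i v ≤ M
  pos_inj : ∀ {i u v}, i ∈ on u → i ∈ on v → pos i u = pos i v → u = v
  pos_rev : ∀ {i j u v}, i ≠ j → i ∈ on u → i ∈ on v → j ∈ on u → j ∈ on v →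
    pos i u < pos i v → pos j v < pos j u
  pos_triangle : ∀ {i j j' v w w'}, j ∈ on v → j ∈ on w → i ∈ on w → i ∈ on w' → j' ∈ on v →
    j' ∈ on w' → pos j v < pos j w → pos i w < pos i w' → pos j' v < pos j' w' →
    (pos j' w' : ℤ) - pos j' v ≤ (pos j w - pos j v) + (pos i w' - pos i w)

theorem card_sq_le_card_mul_card_collisions {α β : Type} [DecidableEq β]
    (s : Finset α) (t : Finset β) (f : α → β) (h : ∀ a ∈ s, f a ∈ t) :
    #s ^ 2 ≤ #t * #{q ∈ s ×ˢ s | f q.1 = f q.2} := by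
  classical
  have h1 : #s = ∑ b ∈ t, #{a ∈ s | f a = b} := card_eq_sum_card_fiberwise h
  have h2 : #{q ∈ s ×ˢ s | f q.1 = f q.2} = ∑ b ∈ t, #{a ∈ s | f a = b} ^ 2 := by
    rw [card_eq_sum_card_fiberwise (f := fun q => f q.1) (t := t)]
    · refine sum_congr rfl fun b _ => ?_
      rw [sq, ← card_product]
      congr 1
      ext ⟨x, y⟩
      simp only [mem_filter, mem_product]
      constructor
      · rintro ⟨⟨⟨a, b⟩, c⟩, d⟩; exact ⟨⟨a, d⟩, b, c ▸ d⟩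
      · rintro ⟨⟨a, b⟩, c, d⟩; exact ⟨⟨⟨a, c⟩, b.trans d.symm⟩, b⟩
    · intro q hq
      simp only [coe_filter, mem_product, Set.mem_ofPred_eq] at hq
      exact h _ hq.1.1
  rw [h2, h1]
  exact sq_sum_le_card_mul_sum_sq

namespace PathSystem

set_option linter.unusedSectionVars false

variable {ι V : Type} [Fintype ι] [Fintype V] [DecidableEq ι] [DecidableEq V] {k M : ℕ}
  (S : PathSystem ι V k M)

/-- The vertices strictly before `w` on path `i`. -/
def before (i : ι) (w : V) : Finset V := {u | i ∈ S.on u ∧ S.pos i u < S.pos i w}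

def rank (i : ι) (w : V) : ℕ := #(S.before i w)

/-- The vertices of path `i`. -/
def verts (i : ι) : Finset V := {u | i ∈ S.on u}

/-- All incidences between paths and vertices. -/
def incs : Finset (ι × V) := {q | q.1 ∈ S.on q.2}

theorem mem_before {i : ι} {u w : V} :
    u ∈ S.before i w ↔ i ∈ S.on u ∧ S.pos i u < S.pos i w := by
  simp [before]

theorem rank_lt_rank {i : ι} {u w : V} (hu : i ∈ S.on u) (h : S.pos i u < S.pos i w) :
    S.rank i u < S.rank i w := by
  apply card_lt_card
  rw [Finset.ssubset_iff_of_subset]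
  · exact ⟨u, S.mem_before.2 ⟨hu, h⟩, fun h' => lt_irrefl _ (S.mem_before.1 h').2⟩
  · intro x hx
    rw [mem_before] at hx ⊢
    exact ⟨hx.1, hx.2.trans h⟩

theorem rank_inj {i : ι} {u w : V} (hu : i ∈ S.on u) (hw : i ∈ S.on w)
    (h : S.rank i u = S.rank i w) : u = w := by
  rcases lt_trichotomy (S.pos i u) (S.pos i w) with h' | h' | h'
  · exact absurd h (S.rank_lt_rank hu h').ne
  · exact S.pos_inj hu hw h'
  · exact absurd h (S.rank_lt_rank hw h').ne'

theorem pos_lt_of_rank_lt {i : ι} {u w : V} (hu : i ∈ S.on u) (hw : i ∈ S.on w)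
    (h : S.rank i u < S.rank i w) : S.pos i u < S.pos i w := by
  rcases lt_trichotomy (S.pos i u) (S.pos i w) with h' | h' | h'
  · exact h'
  · rw [S.pos_inj hu hw h'] at h; exact absurd h (lt_irrefl _)
  · exact absurd (S.rank_lt_rank hw h') h.not_gt

theorem rank_le_card_verts (i : ι) (w : V) : S.rank i w ≤ #(S.verts i) := by
  apply card_le_card
  intro x hx
  simp [verts, (S.mem_before.1 hx).1]

/-- Two vertices in a common order lie on a unique path. -/
theorem path_unique {i j : ι} {u v : V} (hiu : i ∈ S.on u) (hiv : i ∈ S.on v) (hju : j ∈ S.on u)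
    (hjv : j ∈ S.on v) (hi : S.pos i u < S.pos i v) (hj : S.pos j u < S.pos j v) : i = j := by
  by_contra hne
  exact lt_asymm hj (S.pos_rev hne hiu hiv hju hjv hi)

theorem card_incs : #S.incs = Fintype.card V * k := by
  rw [card_eq_sum_card_fiberwise (f := Prod.snd) (t := univ) (by simp [Set.MapsTo])]
  have : ∀ v ∈ (univ : Finset V), #{a ∈ S.incs | a.2 = v} = k := by
    intro v _
    refine Eq.trans (Eq.symm ?_) (S.card_on v)
    apply card_bij (fun i _ => (i, v))
    · intro i hi; simp [incs, hi]
    · intro a _ b _ h; simpa using h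
    · rintro ⟨i, u⟩ h
      simp only [incs, mem_filter, mem_univ, true_and] at h
      exact ⟨i, h.2 ▸ h.1, by rw [h.2]⟩
  rw [sum_congr rfl this]
  simp

theorem sum_card_verts : ∑ i, #(S.verts i) = Fintype.card V * k := by
  rw [← card_incs S, card_eq_sum_card_fiberwise (f := Prod.fst) (t := univ) (s := S.incs)
    (by simp [Set.MapsTo])]
  refine sum_congr rfl fun i _ => ?_
  apply card_bij (fun v _ => (i, v))
  · intro v hv; simpa [verts, incs] using hv
  · intro a _ b _ h; simpa using h
  · rintro ⟨j, u⟩ h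
    simp only [incs, mem_filter, mem_univ, true_and] at h
    exact ⟨u, by simp [verts, ← h.2, h.1], by rw [h.2]⟩

theorem card_verts_le (i : ι) : #(S.verts i) ≤ M := by
  have : #(S.verts i) ≤ #(Icc 1 M) := by
    apply card_le_card_of_injOn (S.pos i)
    · intro v hv
      have hv' : i ∈ S.on v := by simpa [verts] using hv
      simpa using ⟨S.pos_pos hv', S.pos_le hv'⟩
    · intro u hu v hv h
      exact S.pos_inj (by simpa [verts] using hu) (by simpa [verts] using hv) h
  simpa using this

theorem card_mul_le (S : PathSystem ι V k M) : Fintype.card V * k ≤ Fintype.card ι * M := by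
  rw [← S.sum_card_verts]
  calc _ ≤ ∑ _i : ι, M := sum_le_sum fun i _ => S.card_verts_le i
    _ = _ := by simp

theorem k_le [Nonempty V] (S : PathSystem ι V k M) : k ≤ Fintype.card ι := by
  rw [← S.card_on (Classical.arbitrary V)]
  exact card_le_univ _

/-- Incidences of rank at least `r`. -/
def goodIncs (r : ℕ) : Finset (ι × V) := {q ∈ S.incs | r ≤ S.rank q.1 q.2}

theorem card_goodIncs (r : ℕ) :
    Fintype.card V * k ≤ #(S.goodIncs r) + Fintype.card ι * r := by
  rw [← S.card_incs, ← card_filter_add_card_filter_not (s := S.incs) (fun q => r ≤ S.rank q.1 q.2)]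
  apply Nat.add_le_add_left
  have : #{q ∈ S.incs | ¬ r ≤ S.rank q.1 q.2} ≤ #((univ : Finset ι) ×ˢ range r) := by
    apply card_le_card_of_injOn (fun q => (q.1, S.rank q.1 q.2))
    · rintro ⟨i, v⟩ h
      simpa using And.right (by simpa using h)
    · rintro ⟨i, v⟩ h ⟨j, u⟩ h' e
      simp only [incs, coe_filter, mem_filter, mem_univ, true_and, Set.mem_ofPred_eq,
        Prod.mk.injEq] at h h' e
      obtain ⟨rfl, e⟩ := e
      rw [S.rank_inj h.1 h'.1 e]
  simpa using this

theorem card_goodIncs_mul_le (r : ℕ) : #(S.goodIncs r) * r ≤ Fintype.card V ^ 2 := by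
  have h1 : #(S.goodIncs r) * r ≤ #((S.goodIncs r).sigma fun q => S.before q.1 q.2) := by
    rw [card_sigma, ← smul_eq_mul]
    apply card_nsmul_le_sum
    intro q hq
    exact (mem_filter.1 hq).2
  have h2 : #((S.goodIncs r).sigma fun q => S.before q.1 q.2) ≤
      #((univ : Finset V) ×ˢ (univ : Finset V)) := by
    apply card_le_card_of_injOn (fun x => (x.2, x.1.2))
    · intro x _; simp
    · rintro ⟨⟨i, w⟩, v⟩ h ⟨⟨j, w'⟩, v'⟩ h' e
      simp only [goodIncs, incs, coe_sigma, mem_before, Set.mem_sigma_iff, coe_filter, mem_filter,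
        mem_univ, true_and, Set.mem_ofPred_eq, Prod.mk.injEq, Finset.mem_coe] at h h' e
      obtain ⟨rfl, rfl⟩ := e
      rw [S.path_unique h.2.1 h.1.1 h'.2.1 h'.1.1 h.2.2 h'.2.2]
  calc _ ≤ _ := h1.trans h2
    _ = _ := by simp [sq]

/-- The index of the window of `m` consecutive vertices of path `i` containing `w`. -/
def win (m : ℕ) (i : ι) (w : V) : ℕ := S.rank i w / m

/-- Triples `(i, w, j)` where paths `i ≠ j` meet in `w`, the vertex `w` has rank at least `r` on
`j`, and `w` is the last vertex of its window of `i` lying on `j`. -/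
def hits (r m : ℕ) : Finset (ι × V × ι) :=
  {h | h.1 ≠ h.2.2 ∧ h.1 ∈ S.on h.2.1 ∧ h.2.2 ∈ S.on h.2.1 ∧ r ≤ S.rank h.2.2 h.2.1 ∧
    ∀ w', h.1 ∈ S.on w' → h.2.2 ∈ S.on w' → S.win m h.1 w' = S.win m h.1 h.2.1 →
      S.pos h.1 w' ≤ S.pos h.1 h.2.1}

theorem mem_hits {r m : ℕ} {i j : ι} {w : V} : (i, w, j) ∈ S.hits r m ↔
    i ≠ j ∧ i ∈ S.on w ∧ j ∈ S.on w ∧ r ≤ S.rank j w ∧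
    ∀ w', i ∈ S.on w' → j ∈ S.on w' → S.win m i w' = S.win m i w → S.pos i w' ≤ S.pos i w := by
  simp [hits]

theorem hits_unique {r m : ℕ} {i j : ι} {w w' : V} (h : (i, w, j) ∈ S.hits r m)
    (h' : (i, w', j) ∈ S.hits r m) (hw : S.win m i w = S.win m i w') : w = w' := by
  rw [mem_hits] at h h'
  exact S.pos_inj h.2.1 h'.2.1 (le_antisymm (h'.2.2.2.2 _ h.2.1 h.2.2.1 hw)
    (h.2.2.2.2 _ h'.2.1 h'.2.2.1 hw.symm))

theorem card_hits_le (r m : ℕ) : #(S.hits r m) ≤ Fintype.card V * k ^ 2 := by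
  have h1 : #(S.hits r m) ≤ #((univ : Finset V).sigma fun w => S.on w ×ˢ S.on w) := by
    apply card_le_card_of_injOn (fun h => ⟨h.2.1, h.1, h.2.2⟩)
    · rintro ⟨i, w, j⟩ h
      have := S.mem_hits.1 h
      simp [this]
    · rintro ⟨i, w, j⟩ h ⟨i', w', j'⟩ h' e
      simp only [Sigma.mk.injEq, heq_eq_eq, Prod.mk.injEq] at e
      simp [e]
  refine h1.trans (le_of_eq ?_)
  simp [card_sigma, S.card_on, sq]

theorem card_window_le {m : ℕ} (hm : 0 < m) (i : ι) (t : ℕ) :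
    #{w | i ∈ S.on w ∧ S.win m i w = t} ≤ m := by
  have : #{w | i ∈ S.on w ∧ S.win m i w = t} ≤ #(Ico (t * m) (t * m + m)) := by
    apply card_le_card_of_injOn (S.rank i)
    · intro w hw
      simp only [coe_filter, mem_univ, true_and, Set.mem_ofPred_eq] at hw
      have := hw.2
      rw [win, Nat.div_eq_iff hm] at this
      simp only [coe_Ico, Set.mem_Ico]
      omega
    · intro u hu w hw h
      simp only [coe_filter, mem_univ, true_and, Set.mem_ofPred_eq] at hu hw
      exact S.rank_inj hu.1 hw.1 h
  simpa using this

/-- Pairs of hits in the same window of the same path. -/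
def hitPairs (r m : ℕ) : Finset ((ι × V × ι) × (ι × V × ι)) :=
  {q ∈ S.hits r m ×ˢ S.hits r m | q.1.1 = q.2.1 ∧ S.win m q.1.1 q.1.2.1 = S.win m q.2.1 q.2.2.1}

theorem card_hitPairs_le (r : ℕ) {m : ℕ} (hm : 0 < m) :
    #(S.hitPairs r m) ≤ m * k * (Fintype.card V * k ^ 2) := by
  refine le_trans ?_ (Nat.mul_le_mul_left _ (S.card_hits_le r m))
  apply card_le_mul_card_image_of_maps_to (f := Prod.fst)
  · intro q hq
    exact (mem_product.1 (mem_filter.1 hq).1).1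
  rintro ⟨i, w, j⟩ -
  have h1 : #{q ∈ S.hitPairs r m | q.1 = (i, w, j)} ≤
      #((({u | i ∈ S.on u ∧ S.win m i u = S.win m i w} : Finset V)).sigma fun u => S.on u) := by
    apply card_le_card_of_injOn (fun q => ⟨q.2.2.1, q.2.2.2⟩)
    · rintro ⟨⟨i1, w1, j1⟩, ⟨i2, w2, j2⟩⟩ h
      simp only [hitPairs, coe_filter, mem_filter, mem_product, Set.mem_ofPred_eq,
        Prod.mk.injEq, mem_hits] at h
      obtain ⟨⟨⟨h1, h2⟩, rfl, h3⟩, rfl, rfl, rfl⟩ := h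
      simp [h2, h3]
    · rintro ⟨⟨i1, w1, j1⟩, ⟨i2, w2, j2⟩⟩ h ⟨⟨i1', w1', j1'⟩, ⟨i2', w2', j2'⟩⟩ h' e
      simp only [hitPairs, coe_filter, mem_filter, mem_product, Set.mem_ofPred_eq,
        Prod.mk.injEq, Sigma.mk.injEq, heq_eq_eq] at h h' e ⊢
      obtain ⟨⟨_, rfl, _⟩, rfl, rfl, rfl⟩ := h
      obtain ⟨⟨_, rfl, _⟩, rfl, rfl, rfl⟩ := h'
      simp [e]
  refine h1.trans ?_
  simp only [card_sigma, S.card_on, sum_const, smul_eq_mul]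
  exact Nat.mul_le_mul_right _ (S.card_window_le hm i _)

theorem card_hits_ge (r : ℕ) {m : ℕ} (hm : 0 < m) :
    #(S.goodIncs r) * (k - 1) ≤ #(S.hits r m) + Fintype.card V * k * m := by
  classical
  set T : Finset (ι × V × ι) :=
    {h | h.1 ≠ h.2.2 ∧ h.1 ∈ S.on h.2.1 ∧ h.2.2 ∈ S.on h.2.1 ∧ r ≤ S.rank h.2.2 h.2.1} with hT
  have h1 : #(S.goodIncs r) * (k - 1) ≤ #T := by
    calc _ = #((S.goodIncs r).sigma fun q => (S.on q.2).erase q.1) := by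
          rw [card_sigma, sum_congr rfl (g := fun _ => k - 1), sum_const, smul_eq_mul]
          intro q hq
          rw [card_erase_of_mem, S.card_on]
          simpa [goodIncs, incs] using And.left (by simpa [goodIncs, incs] using hq)
      _ ≤ _ := by
          apply card_le_card_of_injOn (fun q => (q.2, q.1.2, q.1.1))
          · rintro ⟨⟨j, w⟩, i⟩ h
            simp only [goodIncs, incs, coe_sigma, Set.mem_sigma_iff, Finset.mem_coe, mem_filter,
              mem_univ, true_and, mem_erase] at h
            simp [hT, h]
          · rintro ⟨⟨j, w⟩, i⟩ h ⟨⟨j', w'⟩, i'⟩ h' e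
            simp only [Prod.mk.injEq] at e
            simp [e]
  set B : Finset (ι × V × ι) := {h ∈ T | ∃ w', h.1 ∈ S.on w' ∧ h.2.2 ∈ S.on w' ∧
    S.win m h.1 w' = S.win m h.1 h.2.1 ∧ S.pos h.1 h.2.1 < S.pos h.1 w'} with hB
  have h2 : T ⊆ S.hits r m ∪ B := by
    rintro ⟨i, w, j⟩ h
    simp only [hT, mem_filter, mem_univ, true_and] at h
    by_cases h' : (i, w, j) ∈ S.hits r m
    · exact mem_union_left _ h'
    · apply mem_union_right
      rw [mem_hits] at h'
      push Not at h'
      simp only [hB, hT, mem_filter, mem_univ, true_and]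
      exact ⟨h, h' h.1 h.2.1 h.2.2.1 h.2.2.2⟩
  have h3 : #B ≤ Fintype.card V * k * m := by
    have hex : ∀ h, ∃ w', h ∈ B → h.1 ∈ S.on w' ∧ h.2.2 ∈ S.on w' ∧
        S.win m h.1 w' = S.win m h.1 h.2.1 ∧ S.pos h.1 h.2.1 < S.pos h.1 w' := by
      intro h
      by_cases hh : h ∈ B
      · exact (mem_filter.1 hh).2.imp fun _ a _ => a
      · exact ⟨h.2.1, fun a => absurd a hh⟩
    choose g hg using hex
    have hBT : ∀ h ∈ B, h ∈ T := fun h hh => (mem_filter.1 hh).1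
    rw [← S.card_incs]
    have : #B ≤ #(S.incs ×ˢ range m) := by
      apply card_le_card_of_injOn (fun h => ((h.1, h.2.1), S.rank h.1 (g h) - S.rank h.1 h.2.1))
      · rintro ⟨i, w, j⟩ h
        have a := hg _ h
        have b := hBT _ h
        simp only [hT, mem_filter, mem_univ, true_and] at a b
        simp only [coe_product, Set.mem_prod, Finset.mem_coe, incs, mem_filter, mem_univ,
          true_and, mem_range]
        refine ⟨b.2.1, ?_⟩
        have c := a.2.2.1
        unfold win at c
        have c1 := Nat.div_add_mod (S.rank i w) m
        have c2 := Nat.div_add_mod (S.rank i (g (i, w, j))) m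
        have c3 := Nat.mod_lt (S.rank i (g (i, w, j))) hm
        rw [c] at c2
        omega
      · rintro ⟨i, w, j⟩ h ⟨i', w', j'⟩ h' e
        simp only [Prod.mk.injEq] at e
        obtain ⟨⟨rfl, rfl⟩, e⟩ := e
        have a := hg _ h
        have b := hBT _ h
        have a' := hg _ h'
        have b' := hBT _ h'
        simp only [hT, mem_filter, mem_univ, true_and] at a b a' b'
        have l := S.rank_lt_rank b.2.1 a.2.2.2
        have l' := S.rank_lt_rank b.2.1 a'.2.2.2
        have e2 : g (i, w, j) = g (i, w, j') := S.rank_inj a.1 a'.1 (by omega)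
        rw [← e2] at a'
        have p1 := S.pos_rev b.1 b.2.1 a.1 b.2.2.1 a.2.1 a.2.2.2
        have p2 := S.pos_rev b'.1 b.2.1 a.1 b'.2.2.1 a'.2.1 a.2.2.2
        rw [S.path_unique a.2.1 b.2.2.1 a'.2.1 b'.2.2.1 p1 p2]
    simpa using this
  have h4 := (card_le_card h2).trans (card_union_le _ _)
  omega

theorem card_sq_le_card_mul_card_add {α β : Type} [DecidableEq α] [DecidableEq β]
    (s : Finset α) (t : Finset β) (f : α → β) (h : ∀ a ∈ s, f a ∈ t) :
    #s ^ 2 ≤ #t * (#s + #{q ∈ s ×ˢ s | f q.1 = f q.2 ∧ q.1 ≠ q.2}) := by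
  refine (card_sq_le_card_mul_card_collisions s t f h).trans (Nat.mul_le_mul_left _ ?_)
  have h1 : {q ∈ s ×ˢ s | f q.1 = f q.2} ⊆
      s.image (fun a => (a, a)) ∪ {q ∈ s ×ˢ s | f q.1 = f q.2 ∧ q.1 ≠ q.2} := by
    rintro ⟨a, b⟩ hq
    simp only [mem_filter, mem_product, mem_union, mem_image, Prod.mk.injEq] at hq ⊢
    by_cases hab : a = b
    · exact Or.inl ⟨a, hq.1.1, rfl, hab⟩
    · exact Or.inr ⟨hq.1, hq.2, hab⟩
  exact (card_le_card h1).trans ((card_union_le _ _).trans (Nat.add_le_add_right card_image_le _))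

/-- Pairs of a hit `(i, w, j)` and a vertex `v` strictly before `w` on `j`. -/
def elts (r m : ℕ) : Finset ((ι × V × ι) × V) :=
  {x | x.1 ∈ S.hits r m ∧ x.2 ∈ S.before x.1.2.2 x.1.2.1}

theorem mem_elts {r m : ℕ} {i j : ι} {w v : V} : ((i, w, j), v) ∈ S.elts r m ↔
    (i, w, j) ∈ S.hits r m ∧ j ∈ S.on v ∧ S.pos j v < S.pos j w := by
  simp [elts, mem_before]

theorem card_hits_mul_le (r m : ℕ) : #(S.hits r m) * r ≤ #(S.elts r m) := by
  have h1 : #(S.hits r m) * r ≤ #((S.hits r m).sigma fun h => S.before h.2.2 h.2.1) := by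
    rw [card_sigma, ← smul_eq_mul]
    apply card_nsmul_le_sum
    rintro ⟨i, w, j⟩ hq
    exact (S.mem_hits.1 hq).2.2.2.1
  refine h1.trans (card_le_card_of_injOn (fun x => (x.1, x.2)) ?_ ?_)
  · rintro ⟨h, v⟩ hx
    simpa [elts] using hx
  · rintro ⟨h, v⟩ _ ⟨h', v'⟩ _ e
    simpa using e

/-- The detour of an element, normalised to be comparable among elements with a common window. -/
def label (x : (ι × V × ι) × V) : ℤ :=
  ((S.pos x.1.2.2 x.1.2.1 : ℤ) - S.pos x.1.2.2 x.2) - S.pos x.1.1 x.1.2.1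

def box (m D : ℕ) (x : (ι × V × ι) × V) : V × (_ : ι) × ℤ :=
  (x.2, ⟨x.1.1, (S.win m x.1.1 x.1.2.1 : ℤ) - S.label x / D⟩)

noncomputable def boxes (m D : ℕ) : Finset (V × (_ : ι) × ℤ) :=
  univ ×ˢ univ.sigma fun i =>
    Icc (-((M / D : ℕ) : ℤ)) ((#(S.verts i) / m : ℕ) + (M / D : ℕ) + 1)

theorem box_mem_boxes {r m D : ℕ} (hD : 0 < D) {x : (ι × V × ι) × V} (hx : x ∈ S.elts r m) :
    S.box m D x ∈ S.boxes m D := by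
  obtain ⟨⟨i, w, j⟩, v⟩ := x
  rw [mem_elts, mem_hits] at hx
  obtain ⟨⟨-, hi, hj, -, -⟩, hv, hlt⟩ := hx
  simp only [boxes, box, mem_product, mem_univ, true_and, mem_sigma, mem_Icc]
  have a1 := S.pos_le hi
  have a2 := S.pos_le hj
  have hl : S.label ((i, w, j), v) ≤ M := by simp only [label]; omega
  have hl' : -(M : ℤ) ≤ S.label ((i, w, j), v) := by simp only [label]; omega
  have hD' : (0 : ℤ) < D := by exact_mod_cast hD
  have b1 := Int.ediv_le_ediv hD' hl
  have b2 := Int.ediv_le_ediv hD' hl'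
  have b3 : -((M : ℤ) / D) - 1 ≤ -(M : ℤ) / D := by
    rw [Int.le_ediv_iff_mul_le hD']
    have := Int.emod_add_mul_ediv (M : ℤ) D
    have := Int.emod_lt_of_pos (M : ℤ) hD'
    nlinarith
  have b4 : S.win m i w ≤ #(S.verts i) / m := Nat.div_le_div_right (S.rank_le_card_verts i w)
  have b5 : (S.win m i w : ℤ) ≤ (#(S.verts i) / m : ℕ) := by exact_mod_cast b4
  have b6 : ((M / D : ℕ) : ℤ) = (M : ℤ) / D := by simp
  constructor
  · rw [b6]
    have := Int.natCast_nonneg (S.win m i w)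
    linarith
  · rw [b6]
    linarith

theorem card_boxes_le (m D : ℕ) : m * #(S.boxes m D) ≤
    Fintype.card V * (Fintype.card V * k + Fintype.card ι * (m * (2 * (M / D) + 2))) := by
  have h1 : #(S.boxes m D) =
      Fintype.card V * ∑ i, (#(S.verts i) / m + (2 * (M / D) + 2)) := by
    rw [boxes, card_product, card_univ, card_sigma]
    congr 1
    refine sum_congr rfl fun i _ => ?_
    rw [Int.card_Icc, ← Int.toNat_natCast (#(S.verts i) / m + (2 * (M / D) + 2))]
    congr 1
    push_cast
    ring
  rw [h1, mul_left_comm]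
  apply Nat.mul_le_mul_left
  rw [sum_add_distrib, mul_add, ← S.sum_card_verts, mul_sum]
  apply Nat.add_le_add
  · exact sum_le_sum fun i _ => Nat.mul_div_le _ _
  · simp only [sum_const, card_univ, smul_eq_mul]
    exact le_of_eq (by ring)

theorem label_anti {r m : ℕ} {i j j' : ι} {w w' v : V} (h : ((i, w, j), v) ∈ S.elts r m)
    (h' : ((i, w', j'), v) ∈ S.elts r m) (hlt : S.pos i w < S.pos i w') :
    S.label ((i, w', j'), v) ≤ S.label ((i, w, j), v) := by
  rw [mem_elts, mem_hits] at h h'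
  have := S.pos_triangle h.2.1 h.1.2.2.1 h.1.2.1 h'.1.2.1 h'.2.1 h'.1.2.2.1 h.2.2 hlt h'.2.2
  simp only [label]
  linarith

theorem win_lt_of_box_eq {r m D : ℕ} (hD : 0 < D) {i j j' : ι} {w w' v : V}
    (h : ((i, w, j), v) ∈ S.elts r m) (h' : ((i, w', j'), v) ∈ S.elts r m)
    (e : S.box m D ((i, w, j), v) = S.box m D ((i, w', j'), v)) :
    ¬ S.win m i w < S.win m i w' := by
  intro hlt
  have hw := (S.mem_hits.1 (S.mem_elts.1 h).1).2.1
  have hw' := (S.mem_hits.1 (S.mem_elts.1 h').1).2.1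
  have h1 : S.rank i w < S.rank i w' := by
    by_contra hc
    exact absurd (Nat.div_le_div_right (c := m) (not_lt.1 hc)) (not_le.2 hlt)
  have h2 := S.label_anti h h' (S.pos_lt_of_rank_lt hw hw' h1)
  have hD' : (0 : ℤ) < D := by exact_mod_cast hD
  have h3 := Int.ediv_le_ediv hD' h2
  simp only [box, Prod.mk.injEq, true_and, Sigma.mk.injEq, heq_eq_eq] at e
  omega

theorem box_eq {r m D : ℕ} (hD : 0 < D) {i i' j j' : ι} {w w' v v' : V}
    (h : ((i, w, j), v) ∈ S.elts r m) (h' : ((i', w', j'), v') ∈ S.elts r m)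
    (e : S.box m D ((i, w, j), v) = S.box m D ((i', w', j'), v')) :
    i = i' ∧ v = v' ∧ S.win m i w = S.win m i' w' ∧
      S.label ((i, w, j), v) / D = S.label ((i', w', j'), v') / D := by
  have e' := e
  simp only [box, Prod.mk.injEq, Sigma.mk.injEq, heq_eq_eq] at e'
  obtain ⟨rfl, rfl, e'⟩ := e'
  have h1 := S.win_lt_of_box_eq hD h h' e
  have h2 := S.win_lt_of_box_eq hD h' h e.symm
  refine ⟨rfl, rfl, ?_, ?_⟩ <;> omega

/-- Pairs of distinct elements in a common box. -/
def coll (r m D : ℕ) : Finset (((ι × V × ι) × V) × ((ι × V × ι) × V)) :=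
  {q ∈ S.elts r m ×ˢ S.elts r m | S.box m D q.1 = S.box m D q.2 ∧ q.1 ≠ q.2}

theorem card_elts_sq_le {r m D : ℕ} (hD : 0 < D) :
    #(S.elts r m) ^ 2 ≤ #(S.boxes m D) * (#(S.elts r m) + #(S.coll r m D)) :=
  card_sq_le_card_mul_card_add _ _ _ fun _ hx => S.box_mem_boxes hD hx

/-- Structure of a pair of distinct elements in a common box. -/
theorem mem_coll {r m D : ℕ} (hD : 0 < D) {i i' j j' : ι} {w w' v v' : V}
    (h : (((i, w, j), v), ((i', w', j'), v')) ∈ S.coll r m D) :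
    i = i' ∧ v = v' ∧ j ≠ j' ∧ S.win m i w = S.win m i w' ∧
    S.label ((i, w, j), v) / D = S.label ((i, w', j'), v) / D ∧
    ((i, w, j), v) ∈ S.elts r m ∧ ((i, w', j'), v) ∈ S.elts r m := by
  simp only [coll, mem_filter, mem_product] at h
  obtain ⟨⟨h1, h2⟩, h3, h4⟩ := h
  obtain ⟨rfl, rfl, h5, h6⟩ := S.box_eq hD h1 h2 h3
  refine ⟨rfl, rfl, ?_, h5, h6, h1, h2⟩
  rintro rfl
  apply h4
  rw [S.hits_unique (S.mem_elts.1 h1).1 (S.mem_elts.1 h2).1 h5]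

/-- Pairs of distinct collisions between the same two hits. -/
def quads (r m D : ℕ) : Finset ((((ι × V × ι) × V) × ((ι × V × ι) × V)) ×
    (((ι × V × ι) × V) × ((ι × V × ι) × V))) :=
  {z ∈ S.coll r m D ×ˢ S.coll r m D |
    (z.1.1.1, z.1.2.1) = (z.2.1.1, z.2.2.1) ∧ z.1 ≠ z.2}

theorem card_coll_sq_le {r m D : ℕ} (hD : 0 < D) :
    #(S.coll r m D) ^ 2 ≤ #(S.hitPairs r m) * (#(S.coll r m D) + #(S.quads r m D)) := by
  refine card_sq_le_card_mul_card_add _ _ (fun q : ((ι × V × ι) × V) × ((ι × V × ι) × V) => (q.1.1, q.2.1)) ?_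
  rintro ⟨⟨⟨i, w, j⟩, v⟩, ⟨⟨i', w', j'⟩, v'⟩⟩ h
  obtain ⟨rfl, rfl, h1, h2, h3, h4, h5⟩ := S.mem_coll hD h
  simp [hitPairs, h2, (S.mem_elts.1 h4).1, (S.mem_elts.1 h5).1]

theorem card_quads_le {r m D : ℕ} (hD : 0 < D) :
    #(S.quads r m D) ≤ 2 * (#(S.elts r m) * (2 * D)) := by
  classical
  have hlt : #{z ∈ S.quads r m D | S.pos z.1.1.1.2.2 z.1.1.2 < S.pos z.1.1.1.2.2 z.2.1.2} ≤
      #(S.elts r m) * (2 * D) := by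
    have : #{z ∈ S.quads r m D | S.pos z.1.1.1.2.2 z.1.1.2 < S.pos z.1.1.1.2.2 z.2.1.2} ≤
        #(S.elts r m ×ˢ range (2 * D)) := by
      apply card_le_card_of_injOn
        (fun z => (z.1.1, S.pos z.1.1.1.2.2 z.2.1.2 - S.pos z.1.1.1.2.2 z.1.1.2))
      · rintro ⟨⟨⟨⟨i, w, j⟩, v⟩, ⟨⟨i1, w', j'⟩, v1⟩⟩, ⟨⟨⟨i2, w2, j2⟩, u⟩, ⟨⟨i3, w3, j3⟩, u1⟩⟩⟩ h
        simp only [quads, coe_filter, mem_filter, mem_product, Set.mem_ofPred_eq,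
          Prod.mk.injEq] at h
        obtain ⟨⟨⟨h1, h2⟩, ⟨⟨rfl, rfl, rfl⟩, ⟨rfl, rfl, rfl⟩⟩, -⟩, h3⟩ := h
        obtain ⟨rfl, rfl, hj, hw, hl, m1, m2⟩ := S.mem_coll hD h1
        obtain ⟨-, rfl, -, -, hl', m3, m4⟩ := S.mem_coll hD h2
        simp only [coe_product, Set.mem_prod, Finset.mem_coe, mem_range]
        refine ⟨m1, ?_⟩
        have e1 := (S.mem_elts.1 m1).2.1
        have e2 := (S.mem_elts.1 m2).2.1
        have e3 := (S.mem_elts.1 m3).2.1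
        have e4 := (S.mem_elts.1 m4).2.1
        have e5 := S.pos_rev hj e1 e3 e2 e4 h3
        have hD' : (0 : ℤ) < D := by exact_mod_cast hD
        have a1 := Int.emod_add_mul_ediv (S.label ((i, w, j), v)) D
        have a2 := Int.emod_add_mul_ediv (S.label ((i, w', j'), v)) D
        have a3 := Int.emod_add_mul_ediv (S.label ((i, w, j), u)) D
        have a4 := Int.emod_add_mul_ediv (S.label ((i, w', j'), u)) D
        have b1 := Int.emod_lt_of_pos (S.label ((i, w, j), v)) hD'
        have b2 := Int.emod_nonneg (S.label ((i, w', j'), v)) hD'.ne'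
        have b3 := Int.emod_nonneg (S.label ((i, w, j), u)) hD'.ne'
        have b4 := Int.emod_lt_of_pos (S.label ((i, w', j'), u)) hD'
        rw [hl] at a1
        rw [hl'] at a3
        have c : S.label ((i, w, j), v) - S.label ((i, w', j'), v) -
          (S.label ((i, w, j), u) - S.label ((i, w', j'), u)) < 2 * D := by linarith
        simp only [label] at c
        omega
      · rintro ⟨⟨⟨⟨i, w, j⟩, v⟩, ⟨⟨i1, w', j'⟩, v1⟩⟩, ⟨⟨⟨i2, w2, j2⟩, u⟩, ⟨⟨i3, w3, j3⟩, u1⟩⟩⟩ h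
          ⟨⟨⟨⟨I, W, J⟩, X⟩, ⟨⟨I1, W', J'⟩, X1⟩⟩, ⟨⟨⟨I2, W2, J2⟩, Y⟩, ⟨⟨I3, W3, J3⟩, Y1⟩⟩⟩ H e
        simp only [quads, coe_filter, mem_filter, mem_product, Set.mem_ofPred_eq,
          Prod.mk.injEq] at h H e
        obtain ⟨⟨⟨rfl, rfl, rfl⟩, rfl⟩, e⟩ := e
        obtain ⟨⟨⟨h1, h2⟩, ⟨⟨rfl, rfl, rfl⟩, ⟨rfl, rfl, rfl⟩⟩, -⟩, h3⟩ := h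
        obtain ⟨rfl, rfl, hj, hw, hl, m1, m2⟩ := S.mem_coll hD h1
        obtain ⟨-, rfl, -, -, hl', m3, m4⟩ := S.mem_coll hD h2
        obtain ⟨⟨⟨H1, H2⟩, ⟨⟨rfl, rfl, rfl⟩, ⟨rfl, rfl, rfl⟩⟩, -⟩, H3⟩ := H
        obtain ⟨rfl, rfl, Hj, Hw, Hl, M1, M2⟩ := S.mem_coll hD H1
        obtain ⟨-, rfl, -, -, Hl', M3, M4⟩ := S.mem_coll hD H2
        have d3 := (S.mem_elts.1 m3).2.1
        have D3 := (S.mem_elts.1 M3).2.1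
        obtain rfl := S.pos_inj d3 D3 (by omega)
        have e1 := (S.mem_elts.1 m1).2.1
        have e2 := (S.mem_elts.1 m2).2.1
        have e4 := (S.mem_elts.1 m4).2.1
        have E2 := (S.mem_elts.1 M2).2.1
        have E4 := (S.mem_elts.1 M4).2.1
        have e5 := S.pos_rev hj e1 d3 e2 e4 h3
        have E5 := S.pos_rev Hj e1 d3 E2 E4 h3
        obtain rfl := S.path_unique e4 e2 E4 E2 e5 E5
        obtain rfl := S.hits_unique (S.mem_elts.1 m2).1 (S.mem_elts.1 M2).1 (hw.symm.trans Hw)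
        rfl
    simpa using this
  have hsub : S.quads r m D ⊆
      {z ∈ S.quads r m D | S.pos z.1.1.1.2.2 z.1.1.2 < S.pos z.1.1.1.2.2 z.2.1.2} ∪
      ({z ∈ S.quads r m D | S.pos z.1.1.1.2.2 z.1.1.2 < S.pos z.1.1.1.2.2 z.2.1.2}).image
        Prod.swap := by
    rintro ⟨⟨⟨⟨i, w, j⟩, v⟩, ⟨⟨i1, w', j'⟩, v1⟩⟩, ⟨⟨⟨i2, w2, j2⟩, u⟩, ⟨⟨i3, w3, j3⟩, u1⟩⟩⟩ h
    have h' := h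
    simp only [quads, mem_filter, mem_product, Prod.mk.injEq] at h'
    obtain ⟨⟨h1, h2⟩, ⟨⟨rfl, rfl, rfl⟩, ⟨rfl, rfl, rfl⟩⟩, hne⟩ := h'
    obtain ⟨rfl, rfl, hj, hw, hl, m1, m2⟩ := S.mem_coll hD h1
    obtain ⟨-, rfl, -, -, hl', m3, m4⟩ := S.mem_coll hD h2
    rw [mem_union]
    rcases lt_trichotomy (S.pos j v) (S.pos j u) with hlt | heq | hgt
    · exact Or.inl (mem_filter.2 ⟨h, hlt⟩)
    · exact absurd (by rw [S.pos_inj (S.mem_elts.1 m1).2.1 (S.mem_elts.1 m3).2.1 heq]) hne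
    · refine Or.inr (mem_image.2 ⟨_, mem_filter.2 ⟨?_, ?_⟩, Prod.swap_swap _⟩)
      · simp only [quads, mem_filter, mem_product, Prod.swap]
        exact ⟨⟨h2, h1⟩, trivial, Ne.symm hne⟩
      · exact hgt
  have := (card_le_card hsub).trans ((card_union_le _ _).trans
    (Nat.add_le_add_left card_image_le _))
  omega

/-- The arithmetic behind `PathSystem.incidence_bound`. -/
theorem incidence_arith {N p k k' m r D R M g h B Y C H Q : ℤ} (hp : 0 < p) (hN : 0 < N)
    (hm0 : 0 < m) (hr0 : 0 ≤ r) (hD0 : 0 < D) (hM0 : 0 ≤ M) (hg0 : 0 ≤ g)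
    (hh0 : 0 ≤ h) (hC0 : 0 ≤ C) (hQ0 : 0 ≤ Q)
    (hk8 : 8 ≤ k) (hk3 : 672 * p ≤ k ^ 3) (hk2 : 2688 * p ^ 2 < N * k ^ 2)
    (hNk : 2688 * p < N * k) (r1 : 2 * p * r ≤ N * k) (r2 : N * k < 2 * p * (r + 1))
    (D1 : p * M < N * D) (D2 : N * D ≤ p * M + N) (D3 : D * R ≤ M) (F10 : N * k ≤ p * M)
    (F1 : N * k ≤ g + p * r) (F2 : g * r ≤ N ^ 2) (F3 : g * k' ≤ h + N * k * m) (F4 : h * r ≤ Y)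
    (F5 : m * B ≤ N * (N * k + p * (m * (2 * R + 2)))) (F6 : Y ^ 2 ≤ B * (Y + C))
    (F7 : C ^ 2 ≤ H * (C + Q)) (F8 : H ≤ m * k * (N * k ^ 2)) (F9 : Q ≤ 2 * (Y * (2 * D)))
    (m1 : 8 * m ≤ k) (m2 : k ≤ 16 * m) (k1 : 7 * k ≤ 8 * k') :
    N ^ 2 * k ^ 5 ≤ 15000000 * (p ^ 4 * M) := by
  have hk0 : 0 < k := by linarith only [hk8]
  have hNk0 : 0 < N * k := by positivity
  have r3 : N * k ≤ 4 * (p * r) := by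
    have : 1 ≤ r := by
      by_contra! hc
      have : r = 0 := by omega
      subst this
      linarith only [r2, hNk, hp]
    have : p * 1 ≤ p * r := by gcongr
    linarith only [this, r2]
  have g1 : N * k ≤ 2 * g := by linarith only [F1, r1]
  have k2 : k ^ 2 ≤ 8 * p := by
    have h1 : (N * k) * (N * k) ≤ (2 * g) * (4 * (p * r)) := by gcongr
    have h2 : (8 * p) * (g * r) ≤ 8 * p * N ^ 2 := by gcongr
    have : N ^ 2 * k ^ 2 ≤ N ^ 2 * (8 * p) := by linarith only [h1, h2]
    exact le_of_mul_le_mul_left this (by positivity)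
  have N1 : 336 * p ≤ N := by
    have h1 : 2688 * p ^ 2 ≤ N * (8 * p) := hk2.le.trans (by gcongr)
    have h2 : p * (8 * (336 * p)) ≤ p * (8 * N) := by linarith only [h1]
    have := le_of_mul_le_mul_left h2 (by positivity)
    linarith only [this]
  have h1 : N * k ^ 2 ≤ 4 * h := by
    have a1 : (N * k) * (7 * k) ≤ (2 * g) * (8 * k') := by gcongr
    have a2 : (N * k) * (8 * m) ≤ (N * k) * k := by gcongr
    have a3 : 0 ≤ N * k ^ 2 := by positivity
    linarith only [a1, a2, a3, F3]
  have Y1 : N ^ 2 * k ^ 3 ≤ 16 * p * Y := by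
    have a1 : N * k ^ 2 * (N * k) ≤ (4 * h) * (4 * (p * r)) := by gcongr
    have a2 : h * r * p ≤ Y * p := by gcongr
    linarith
  have Y2 : 42 * N ^ 2 ≤ Y := by
    have a1 : N ^ 2 * (672 * p) ≤ N ^ 2 * k ^ 3 := by gcongr
    have : 16 * p * (42 * N ^ 2) ≤ 16 * p * Y := by linarith
    exact le_of_mul_le_mul_left this (by positivity)
  have hY0 : 0 < Y := lt_of_lt_of_le (by positivity) Y2
  have D4 : p * R ≤ N := by
    have a1 : p * (D * R) ≤ p * M := by gcongr
    have : D * (p * R) ≤ D * N := by linarith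
    exact le_of_mul_le_mul_left this (by positivity)
  have B1 : B ≤ 21 * N ^ 2 := by
    have a1 : N * (N * k) ≤ N * (N * (16 * m)) := by gcongr
    have a2 : N * m * (p * R) ≤ N * m * N := by gcongr
    have a3 : N * m * (336 * p) ≤ N * m * N := by gcongr
    have a4 : 0 ≤ N * m * N := by positivity
    have : m * B ≤ m * (21 * N ^ 2) := by linarith
    exact le_of_mul_le_mul_left this (by positivity)
  have Y3 : Y ^ 2 ≤ 42 * N ^ 2 * C := by
    have a1 : B * (Y + C) ≤ 21 * N ^ 2 * (Y + C) := by gcongr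
    have a2 : 42 * N ^ 2 * Y ≤ Y * Y := by gcongr
    linarith
  have C1 : 8 * C ^ 2 ≤ N * k ^ 4 * (C + 4 * (Y * D)) := by
    have a0 : (k * (N * k ^ 2)) * (8 * m) ≤ k * (N * k ^ 2) * k := by gcongr
    have a1 : 8 * H ≤ N * k ^ 4 := by linarith
    have a2 : Q ≤ 4 * (Y * D) := by linarith
    calc (8 * C ^ 2) ≤ (8 * H) * (C + Q) := by linarith
      _ ≤ _ := by gcongr
  have hYD : 0 < Y * D := by positivity
  rcases le_total (4 * (Y * D)) C with hc | hc
  · have hC0 : 0 < C := by linarith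
    have C2 : 4 * C ≤ N * k ^ 4 := by
      have : N * k ^ 4 * (C + 4 * (Y * D)) ≤ N * k ^ 4 * (C + C) := by gcongr
      have : 2 * C * (4 * C) ≤ 2 * C * (N * k ^ 4) := by linarith
      exact le_of_mul_le_mul_left this (by positivity)
    have a1 : (N ^ 2 * k ^ 3) ^ 2 ≤ (16 * p * Y) ^ 2 := by gcongr
    have a2 : 42 * N ^ 2 * (4 * C) ≤ 42 * N ^ 2 * (N * k ^ 4) := by gcongr
    have a3 : 64 * p ^ 2 * (4 * Y ^ 2) ≤ 64 * p ^ 2 * (42 * N ^ 2 * (N * k ^ 4)) :=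
      mul_le_mul_of_nonneg_left (by linarith) (by positivity)
    have : N ^ 3 * k ^ 4 * (N * k ^ 2) ≤ N ^ 3 * k ^ 4 * (2688 * p ^ 2) := by linarith
    have := le_of_mul_le_mul_left this (by positivity)
    linarith
  · have C2 : C ^ 2 ≤ N * k ^ 4 * (Y * D) := by
      have : N * k ^ 4 * (C + 4 * (Y * D)) ≤ N * k ^ 4 * (4 * (Y * D) + 4 * (Y * D)) := by
        gcongr
      linarith
    have D5 : N * D ≤ 2 * (p * M) := by
      have : N * 1 ≤ N * k := by gcongr; linarith
      linarith
    have a1 : (Y ^ 2) ^ 2 ≤ (42 * N ^ 2 * C) ^ 2 := by gcongr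
    have a2 : 1764 * N ^ 4 * C ^ 2 ≤ 1764 * N ^ 4 * (N * k ^ 4 * (Y * D)) := by gcongr
    have a3 : 1764 * N ^ 4 * k ^ 4 * Y * (N * D) ≤
      1764 * N ^ 4 * k ^ 4 * Y * (2 * (p * M)) := by gcongr
    have a4 : Y ^ 3 ≤ 3528 * N ^ 4 * k ^ 4 * (p * M) := by
      have : Y * Y ^ 3 ≤ Y * (3528 * N ^ 4 * k ^ 4 * (p * M)) := by linarith
      exact le_of_mul_le_mul_left this hY0
    have a5 : (N ^ 2 * k ^ 3) ^ 3 ≤ (16 * p * Y) ^ 3 := by gcongr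
    have a6 : 4096 * p ^ 3 * Y ^ 3 ≤ 4096 * p ^ 3 * (3528 * N ^ 4 * k ^ 4 * (p * M)) := by
      gcongr
    have : N ^ 4 * k ^ 4 * (N ^ 2 * k ^ 5) ≤ N ^ 4 * k ^ 4 * (14450688 * (p ^ 4 * M)) := by
      linarith
    have := le_of_mul_le_mul_left this (by positivity)
    have : 0 ≤ p ^ 4 * M := by positivity
    linarith

/-- Either the system is sparse, or it has few incidences in terms of `p⁴ M`. -/
theorem incidence_bound (S : PathSystem ι V k M) :
    k < 8 ∨ k ^ 3 < 672 * Fintype.card ι ∨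
    Fintype.card V * k ^ 2 ≤ 2688 * Fintype.card ι ^ 2 ∨
    Fintype.card V ^ 2 * k ^ 5 ≤ 15000000 * (Fintype.card ι ^ 4 * M) := by
  by_contra! ⟨hk8, hk3, hk2, hfinal⟩
  have hV : Nonempty V := by
    by_contra hc
    rw [not_nonempty_iff] at hc
    simp at hk2
  have hkp := S.k_le
  have F10 := S.card_mul_le
  have hN : 0 < Fintype.card V := Fintype.card_pos
  have hp : 0 < Fintype.card ι := by omega
  obtain ⟨m, hm⟩ : ∃ m, m = k / 8 := ⟨_, rfl⟩
  obtain ⟨r, hr⟩ : ∃ r, r = Fintype.card V * k / (2 * Fintype.card ι) := ⟨_, rfl⟩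
  obtain ⟨D, hD⟩ : ∃ D, D = Fintype.card ι * M / Fintype.card V + 1 := ⟨_, rfl⟩
  have hm0 : 0 < m := by omega
  have hD0 : 0 < D := hD ▸ Nat.succ_pos _
  have hNk : 2688 * Fintype.card ι < Fintype.card V * k := by
    by_contra! hc
    have : Fintype.card V * k ^ 2 ≤ 2688 * Fintype.card ι ^ 2 := by
      calc Fintype.card V * k ^ 2 = Fintype.card V * k * k := by ring
        _ ≤ 2688 * Fintype.card ι * Fintype.card ι := Nat.mul_le_mul hc hkp
        _ = _ := by ring
    omega
  have r1 : 2 * Fintype.card ι * r ≤ Fintype.card V * k := hr ▸ Nat.mul_div_le _ _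
  have r2 : Fintype.card V * k < 2 * Fintype.card ι * (r + 1) := by
    rw [hr]; exact Nat.lt_mul_div_succ _ (by omega)
  have D1 : Fintype.card ι * M < Fintype.card V * D := by rw [hD]; exact Nat.lt_mul_div_succ _ hN
  have D2 : Fintype.card V * D ≤ Fintype.card ι * M + Fintype.card V := by
    rw [hD, mul_add, mul_one]; exact Nat.add_le_add_right (Nat.mul_div_le _ _) _
  have D3 : D * (M / D) ≤ M := Nat.mul_div_le _ _
  have F1 := S.card_goodIncs r
  have F2 := S.card_goodIncs_mul_le r
  have F3 := S.card_hits_ge r hm0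
  have F4 := S.card_hits_mul_le r m
  have F5 := S.card_boxes_le m D
  have F6 := S.card_elts_sq_le (r := r) (m := m) hD0
  have F7 := S.card_coll_sq_le (r := r) (m := m) hD0
  have F8 := S.card_hitPairs_le r hm0
  have F9 := S.card_quads_le (r := r) (m := m) hD0
  have m1 : 8 * m ≤ k := by omega
  have m2 : k ≤ 16 * m := by omega
  have k1 : 7 * k ≤ 8 * (k - 1) := by omega
  refine absurd hfinal (not_lt.2 ?_)
  have := @incidence_arith (Fintype.card V) (Fintype.card ι) k (k - 1 : ℕ) m r D (M / D : ℕ) M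
    #(S.goodIncs r) #(S.hits r m) #(S.boxes m D) #(S.elts r m) #(S.coll r m D)
    #(S.hitPairs r m) #(S.quads r m D)
  norm_cast at this
  exact this hp hN hm0 (Nat.zero_le _) hD0 (Nat.zero_le _)
    (Nat.zero_le _) (Nat.zero_le _) (Nat.zero_le _) (Nat.zero_le _) hk8 hk3 hk2 hNk r1 r2 D1 D2 D3
    F10 F1 F2 F3 F4 F5 F6 F7 F8 F9 m1 m2 k1

end PathSystem
/-- There is a walk with exactly `n` edges, all in `E`, from `u` to `v`. -/
def HasWalk {V : Type} (E : Finset (V × V)) : ℕ → V → V → Prop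
  | 0, u, v => u = v
  | n + 1, u, v => ∃ w, (u, w) ∈ E ∧ HasWalk E n w v

namespace HasWalk

variable {V : Type} {E F : Finset (V × V)}

theorem trans {a b : ℕ} {u v w : V} (h : HasWalk E a u v) (h' : HasWalk E b v w) :
    HasWalk E (a + b) u w := by
  induction a generalizing u with
  | zero =>
    have : u = v := h
    subst this
    simpa using h'
  | succ a ih =>
    obtain ⟨x, hx, h⟩ := h
    rw [Nat.add_right_comm]
    exact ⟨x, hx, ih h⟩

theorem single {u v : V} (h : (u, v) ∈ E) : HasWalk E 1 u v := ⟨v, h, rfl⟩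

theorem mono (hFE : F ⊆ E) {n : ℕ} {u v : V} (h : HasWalk F n u v) : HasWalk E n u v := by
  induction n generalizing u with
  | zero => exact h
  | succ n ih =>
    obtain ⟨x, hx, h⟩ := h
    exact ⟨x, hFE hx, ih h⟩

theorem exists_list {n : ℕ} {u v : V} (h : HasWalk E n u v) :
    ∃ l, IsWalkOn E u v l ∧ l.length = n + 1 := by
  induction n generalizing u with
  | zero =>
    have : u = v := h
    subst this
    exact ⟨[u], ⟨List.isChain_singleton _, rfl, rfl⟩, rfl⟩
  | succ n ih =>
    obtain ⟨x, hx, h⟩ := h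
    obtain ⟨l, ⟨h1, h2, h3⟩, h4⟩ := ih h
    cases l with
    | nil => simp at h4
    | cons y l =>
      obtain rfl : y = x := by simpa using h2
      refine ⟨u :: y :: l, ⟨?_, rfl, ?_⟩, by simpa using h4⟩
      · exact List.isChain_cons_cons.2 ⟨hx, h1⟩
      · rw [List.getLast?_cons_cons]
        exact h3

end HasWalk

theorem IsWalkOn.hasWalk {V : Type} {E : Finset (V × V)} {u v : V} {l : List V}
    (h : IsWalkOn E u v l) : ∃ n, HasWalk E n u v ∧ l.length = n + 1 := by
  induction l generalizing u with
  | nil => simp [IsWalkOn] at h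
  | cons x l ih =>
    obtain ⟨h1, h2, h3⟩ := h
    obtain rfl : x = u := by simpa using h2
    cases l with
    | nil => exact ⟨0, show x = v by simpa using h3, rfl⟩
    | cons y l =>
      obtain ⟨h4, h5⟩ := List.isChain_cons_cons.1 h1
      rw [List.getLast?_cons_cons] at h3
      obtain ⟨n, h6, h7⟩ := ih ⟨h5, rfl, h3⟩
      exact ⟨n + 1, ⟨y, h4, h6⟩, by simpa using h7⟩

theorem WDigraph.Unweighted.walkWeight_eq {V : Type} {G : WDigraph V} (hG : G.Unweighted)
    {F : Finset (V × V)} (hF : F ⊆ G.Edge) {u v : V} {l : List V} {n : ℕ}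
    (h : IsWalkOn F u v l) (hl : l.length = n + 1) : G.walkWeight l = n := by
  induction n generalizing u l with
  | zero =>
    obtain ⟨x, rfl⟩ := List.length_eq_one_iff.1 hl
    simp [WDigraph.walkWeight]
  | succ n ih =>
    match l, hl with
    | x :: y :: l, hl =>
      obtain ⟨h1, -, h3⟩ := h
      obtain ⟨h4, h5⟩ := List.isChain_cons_cons.1 h1
      rw [List.getLast?_cons_cons] at h3
      have := ih (u := y) (l := y :: l) ⟨h5, rfl, h3⟩ (by simpa using hl)
      simp only [WDigraph.walkWeight, List.tail_cons, List.zip_cons_cons, List.map_cons,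
        List.sum_cons] at this ⊢
      rw [this, hG _ (hF h4)]
      push_cast
      ring

theorem WDigraph.Unweighted.distOn_eq {V : Type} {G : WDigraph V} (hG : G.Unweighted)
    {F : Finset (V × V)} (hF : F ⊆ G.Edge) {u v : V} {n : ℕ} (h : HasWalk F n u v)
    (hmin : ∀ m, HasWalk F m u v → n ≤ m) : G.distOn F u v = n := by
  apply IsLeast.csInf_eq
  constructor
  · obtain ⟨l, h1, h2⟩ := h.exists_list
    exact ⟨l, h1, hG.walkWeight_eq hF h1 h2⟩
  · rintro x ⟨l, h1, rfl⟩
    obtain ⟨m, h2, h3⟩ := h1.hasWalk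
    rw [hG.walkWeight_eq hF h1 h3]
    exact_mod_cast hmin m h2

/-- The least number of edges of a walk from `u` to `v`. -/
noncomputable def hop {V : Type} (E : Finset (V × V)) (u v : V) : ℕ := sInf {n | HasWalk E n u v}

section Hop

variable {V : Type} {E : Finset (V × V)}

theorem HasWalk.hop_le {n : ℕ} {u v : V} (h : HasWalk E n u v) : hop E u v ≤ n := Nat.sInf_le h

theorem HasWalk.hop_spec {n : ℕ} {u v : V} (h : HasWalk E n u v) : HasWalk E (hop E u v) u v := by
  have : hop E u v ∈ {n | HasWalk E n u v} := Nat.sInf_mem ⟨n, h⟩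
  simpa using this

variable [LinearOrder V] [Fintype V]

/-- The out-neighbours of `u` that are one step closer to `t`. -/
noncomputable def closer (E : Finset (V × V)) (u t : V) : Finset V :=
  open Classical in
  {w | (u, w) ∈ E ∧ HasWalk E (hop E w t) w t ∧ hop E w t + 1 = hop E u t}

theorem mem_closer {u t w : V} : w ∈ closer E u t ↔
    (u, w) ∈ E ∧ HasWalk E (hop E w t) w t ∧ hop E w t + 1 = hop E u t := by
  simp [closer]

noncomputable def nextStep (E : Finset (V × V)) (u t : V) : V :=
  if h : (closer E u t).Nonempty then (closer E u t).min' h else u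

theorem nextStep_mem {u t : V} (h : HasWalk E (hop E u t) u t) (h0 : 0 < hop E u t) :
    nextStep E u t ∈ closer E u t := by
  have : (closer E u t).Nonempty := by
    obtain ⟨n, hn⟩ := Nat.exists_eq_succ_of_ne_zero h0.ne'
    rw [hn] at h
    obtain ⟨w, hw, h⟩ := h
    refine ⟨w, mem_closer.2 ⟨hw, h.hop_spec, ?_⟩⟩
    have h1 := h.hop_le
    have h2 := ((HasWalk.single hw).trans h.hop_spec).hop_le
    omega
  rw [nextStep, dif_pos this]
  exact min'_mem _ _

theorem nextStep_eq {u v t : V} (hsub : closer E u v ⊆ closer E u t)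
    (hmem : nextStep E u t ∈ closer E u v) : nextStep E u t = nextStep E u v := by
  have hv : (closer E u v).Nonempty := ⟨_, hmem⟩
  have ht : (closer E u t).Nonempty := hv.mono hsub
  rw [nextStep, dif_pos ht] at hmem ⊢
  rw [nextStep, dif_pos hv]
  exact le_antisymm (min'_le _ _ (hsub (min'_mem _ _))) (min'_le _ _ hmem)

/-- The canonical shortest path from `s` to `t`. -/
noncomputable def canon (E : Finset (V × V)) (s t : V) : ℕ → V
  | 0 => s
  | a + 1 => nextStep E (canon E s t a) t

theorem hasWalk_canon {F : Finset (V × V)} {s t : V}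
    (hF : ∀ a < hop E s t, (canon E s t a, canon E s t (a + 1)) ∈ F) {a c : ℕ}
    (hac : a + c ≤ hop E s t) : HasWalk F c (canon E s t a) (canon E s t (a + c)) := by
  induction c with
  | zero => rfl
  | succ c ih => exact (ih (by omega)).trans (HasWalk.single (hF _ (by omega)))

section Canon

variable {s t : V} (h : HasWalk E (hop E s t) s t)

include h

theorem canon_spec {a : ℕ} (ha : a ≤ hop E s t) :
    HasWalk E (hop E (canon E s t a) t) (canon E s t a) t ∧
      hop E (canon E s t a) t + a = hop E s t := by
  induction a with
  | zero => exact ⟨h, rfl⟩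
  | succ a ih =>
    obtain ⟨h1, h2⟩ := ih (by omega)
    have h3 := mem_closer.1 (nextStep_mem h1 (by omega))
    exact ⟨h3.2.1, by rw [canon]; omega⟩

theorem canon_succ_mem {a : ℕ} (ha : a < hop E s t) :
    canon E s t (a + 1) ∈ closer E (canon E s t a) t := by
  obtain ⟨h1, h2⟩ := canon_spec h ha.le
  exact nextStep_mem h1 (by omega)

theorem canon_last : canon E s t (hop E s t) = t := by
  obtain ⟨h1, h2⟩ := canon_spec h le_rfl
  have h3 : hop E (canon E s t (hop E s t)) t = 0 := by omega
  rw [h3] at h1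
  exact h1

theorem hasWalk_canon_self {a c : ℕ} (hac : a + c ≤ hop E s t) :
    HasWalk E c (canon E s t a) (canon E s t (a + c)) :=
  hasWalk_canon (fun _ ha => (mem_closer.1 (canon_succ_mem h ha)).1) hac

theorem hop_canon {a c : ℕ} (hac : a + c ≤ hop E s t) :
    hop E (canon E s t a) (canon E s t (a + c)) = c := by
  have h1 := hasWalk_canon_self h hac
  have h2 := canon_spec h (show a ≤ hop E s t by omega)
  have h3 := canon_spec h hac
  have h4 := (h1.hop_spec.trans h3.1).hop_le
  have h5 := h1.hop_le
  omega

theorem hop_canon_zero {a : ℕ} (ha : a ≤ hop E s t) : hop E s (canon E s t a) = a := by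
  have := hop_canon h (a := 0) (c := a) (by omega)
  rwa [Nat.zero_add] at this

theorem nextStep_canon {a b : ℕ} (hab : a < b) (hb : b ≤ hop E s t) :
    nextStep E (canon E s t a) t = nextStep E (canon E s t a) (canon E s t b) := by
  obtain ⟨c, rfl⟩ := Nat.exists_eq_add_of_lt hab
  have e1 := hop_canon h (a := a) (c := c + 1) (by omega)
  have e2 := hop_canon h (a := a + 1) (c := c) (by omega)
  have w2 := hasWalk_canon_self h (a := a + 1) (c := c) (by omega)
  rw [show a + 1 + c = a + c + 1 by omega] at e2 w2
  rw [show a + (c + 1) = a + c + 1 by omega] at e1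
  have ha := canon_spec h (show a ≤ hop E s t by omega)
  have hb' := canon_spec h hb
  apply nextStep_eq
  · intro w hw
    rw [mem_closer] at hw ⊢
    obtain ⟨h1, h2, h3⟩ := hw
    have h4 := h2.trans hb'.1
    refine ⟨h1, h4.hop_spec, ?_⟩
    have h5 := h4.hop_le
    have h6 := ((HasWalk.single h1).trans h4.hop_spec).hop_le
    omega
  · change canon E s t (a + 1) ∈ _
    rw [mem_closer]
    refine ⟨(mem_closer.1 (canon_succ_mem h (by omega))).1, w2.hop_spec, by omega⟩

/-- Subpaths of canonical paths are canonical. -/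
theorem canon_add {a b c : ℕ} (hac : a + c ≤ b) (hb : b ≤ hop E s t) :
    canon E s t (a + c) = canon E (canon E s t a) (canon E s t b) c := by
  induction c with
  | zero => rfl
  | succ c ih =>
    rw [canon, ← ih (by omega), ← nextStep_canon h (by omega) hb]
    rfl

end Canon

end Hop

theorem exists_disjoint_subsets {α : Type} [DecidableEq α] (s : Finset α) {k : ℕ} (hk : 0 < k) :
    ∃ f : Fin (#s / k) → Finset α, (∀ t, f t ⊆ s ∧ #(f t) = k) ∧
      ∀ t t' x, x ∈ f t → x ∈ f t' → t = t' := by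
  let e := s.equivFin
  refine ⟨fun t => (univ.filter fun n : Fin #s => n.1 / k = t.1).image fun n => (e.symm n).1,
    fun t => ⟨?_, ?_⟩, ?_⟩
  · intro x hx
    obtain ⟨n, -, rfl⟩ := mem_image.1 hx
    exact (e.symm n).2
  · refine (card_image_of_injective _ (Subtype.val_injective.comp e.symm.injective)).trans ?_
    have hlt : (t.1 + 1) * k ≤ #s :=
      (Nat.mul_le_mul_right k t.2).trans (Nat.div_mul_le_self _ _)
    have : #(univ.filter fun n : Fin #s => n.1 / k = t.1) = #(Ico (t.1 * k) (t.1 * k + k)) := by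
      apply card_bij (fun n _ => n.1)
      · intro n hn
        have := (mem_filter.1 hn).2
        rw [Nat.div_eq_iff hk] at this
        rw [mem_Ico]
        omega
      · intro a _ b _ hab
        exact Fin.ext hab
      · intro b hb
        rw [mem_Ico] at hb
        refine ⟨⟨b, by rw [add_mul] at hlt; omega⟩, mem_filter.2 ⟨mem_univ _, ?_⟩, rfl⟩
        rw [Nat.div_eq_iff hk]
        change _ ≤ b ∧ b ≤ _
        omega
    rw [this, Nat.card_Ico]
    omega
  · intro t t' x hx hx'
    obtain ⟨n, hn, rfl⟩ := mem_image.1 hx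
    obtain ⟨n', hn', h⟩ := mem_image.1 hx'
    have := e.symm.injective (Subtype.val_injective h)
    subst this
    exact Fin.ext ((mem_filter.1 hn).2.symm.trans (mem_filter.1 hn').2)

section CanonEdges

variable {V : Type} [LinearOrder V] [Fintype V] {E P : Finset (V × V)}

/-- The canonical path of the pair `q` traverses the edge `e`. -/
def Traverses (E : Finset (V × V)) (q e : V × V) : Prop :=
  ∃ a < hop E q.1 q.2, (canon E q.1 q.2 a, canon E q.1 q.2 (a + 1)) = e

/-- The union of the canonical paths of the pairs in `P`. -/
noncomputable def canonEdges (E P : Finset (V × V)) : Finset (V × V) :=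
  P.biUnion fun q => (range (hop E q.1 q.2)).image fun a =>
    (canon E q.1 q.2 a, canon E q.1 q.2 (a + 1))

theorem mem_canonEdges {e : V × V} : e ∈ canonEdges E P ↔ ∃ q ∈ P, Traverses E q e := by
  simp [canonEdges, Traverses]

variable {q q' e e' : V × V}

theorem Traverses.hop_eq (hq : HasWalk E (hop E q.1 q.2) q.1 q.2) (h : Traverses E q e) :
    1 ≤ hop E q.1 e.2 ∧ hop E q.1 e.2 ≤ hop E q.1 q.2 ∧
      canon E q.1 q.2 (hop E q.1 e.2) = e.2 ∧
      e.1 = canon E q.1 q.2 (hop E q.1 e.2 - 1) := by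
  obtain ⟨a, ha, rfl⟩ := h
  have h1 : hop E q.1 (canon E q.1 q.2 (a + 1)) = a + 1 := hop_canon_zero hq ha
  simp only [h1]
  exact ⟨by omega, ha, trivial, rfl⟩

theorem Traverses.eq_of_snd_eq (hq : HasWalk E (hop E q.1 q.2) q.1 q.2) (h : Traverses E q e)
    (h' : Traverses E q e') (hv : e.2 = e'.2) : e = e' := by
  have h1 := h.hop_eq hq
  have h2 := h'.hop_eq hq
  refine Prod.ext ?_ hv
  rw [h1.2.2.2, h2.2.2.2, hv]

/-- Two canonical paths visiting `u` and later `v` enter `v` through the same edge. -/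
theorem Traverses.eq_of_common {d d' : V × V} (hq : HasWalk E (hop E q.1 q.2) q.1 q.2)
    (hq' : HasWalk E (hop E q'.1 q'.2) q'.1 q'.2)
    (hd : Traverses E q d) (hd' : Traverses E q' d') (h : Traverses E q e)
    (h' : Traverses E q' e') (hu : d.2 = d'.2) (hv : e.2 = e'.2)
    (hlt : hop E q.1 d.2 < hop E q.1 e.2) (hlt' : hop E q'.1 d'.2 < hop E q'.1 e'.2) : e = e' := by
  refine Prod.ext ?_ hv
  obtain ⟨-, -, d3, -⟩ := hd.hop_eq hq
  obtain ⟨-, -, d3', -⟩ := hd'.hop_eq hq'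
  obtain ⟨-, e2, e3, e4⟩ := h.hop_eq hq
  obtain ⟨-, e2', e3', e4'⟩ := h'.hop_eq hq'
  obtain ⟨c, hc⟩ := Nat.exists_eq_add_of_lt hlt
  obtain ⟨c', hc'⟩ := Nat.exists_eq_add_of_lt hlt'
  have k1 := hop_canon hq (a := hop E q.1 d.2) (c := c + 1) (by omega)
  have k2 := hop_canon hq' (a := hop E q'.1 d'.2) (c := c' + 1) (by omega)
  rw [← add_assoc, ← hc, d3, e3] at k1
  rw [← add_assoc, ← hc', d3', e3', ← hu, ← hv, k1] at k2
  obtain rfl : c = c' := by omega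
  have l1 := canon_add hq (a := hop E q.1 d.2) (b := hop E q.1 e.2) (c := c) (by omega) e2
  have l2 := canon_add hq' (a := hop E q'.1 d'.2) (b := hop E q'.1 e'.2) (c := c) (by omega) e2'
  rw [d3, e3] at l1
  rw [d3', e3'] at l2
  rw [e4, e4', show hop E q.1 e.2 - 1 = hop E q.1 d.2 + c by omega,
    show hop E q'.1 e'.2 - 1 = hop E q'.1 d'.2 + c by omega, l1, l2, hu, hv]

theorem hop_le_hop_sub (hq : HasWalk E (hop E q.1 q.2) q.1 q.2) (h : Traverses E q e)
    (h' : Traverses E q e') (hlt : hop E q.1 e.2 < hop E q.1 e'.2) :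
    HasWalk E (hop E e.2 e'.2) e.2 e'.2 ∧
      hop E q.1 e.2 + hop E e.2 e'.2 = hop E q.1 e'.2 := by
  obtain ⟨-, e2, e3, e4⟩ := h.hop_eq hq
  obtain ⟨-, e2', e3', e4'⟩ := h'.hop_eq hq
  obtain ⟨c, hc⟩ := Nat.exists_eq_add_of_lt hlt
  have k0 := hasWalk_canon_self hq (a := hop E q.1 e.2) (c := c + 1) (by omega)
  have k1 := hop_canon hq (a := hop E q.1 e.2) (c := c + 1) (by omega)
  rw [← add_assoc, ← hc, e3, e3'] at k0 k1
  exact ⟨k0.hop_spec, by omega⟩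

/-- The union of canonical paths gives rise to a path system, after splitting every vertex into
groups of `k` incoming edges. -/
theorem card_canonEdges (hP : ∀ q ∈ P, HasWalk E (hop E q.1 q.2) q.1 q.2) {M k : ℕ}
    (hM : ∀ q ∈ P, hop E q.1 q.2 ≤ M) (hk : 0 < k) :
    ∃ N, N * k ≤ #(canonEdges E P) ∧ #(canonEdges E P) ≤ N * k + Fintype.card V * k ∧
      (k < 8 ∨ k ^ 3 < 672 * #P ∨ N * k ^ 2 ≤ 2688 * #P ^ 2 ∨
        N ^ 2 * k ^ 5 ≤ 15000000 * (#P ^ 4 * M)) := by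
  classical
  have hown : ∀ e, ∃ q, e ∈ canonEdges E P → q ∈ P ∧ Traverses E q e := by
    intro e
    by_cases he : e ∈ canonEdges E P
    · exact (mem_canonEdges.1 he).imp fun _ h _ => h
    · exact ⟨e, fun h => absurd h he⟩
  choose own hown using hown
  let O : V → Finset P := fun v =>
    univ.filter fun i => ∃ e ∈ canonEdges E P, e.2 = v ∧ own e = i.1
  have hO : ∀ {v i}, i ∈ O v → ∃ e ∈ canonEdges E P, Traverses E i.1 e ∧ e.2 = v ∧ own e = i.1 := by
    intro v i hi
    obtain ⟨e, he, hv, ho⟩ := (mem_filter.1 hi).2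
    exact ⟨e, he, ho ▸ (hown e he).2, hv, ho⟩
  have hcard : #(canonEdges E P) = ∑ v, #(O v) := by
    rw [card_eq_sum_card_fiberwise (f := Prod.snd) (t := univ) (by simp [Set.MapsTo])]
    refine sum_congr rfl fun v _ => ?_
    apply card_bij (fun e he => (⟨own e, (hown e (mem_filter.1 he).1).1⟩ : P))
    · intro e he
      exact mem_filter.2 ⟨mem_univ _, e, (mem_filter.1 he).1, (mem_filter.1 he).2, rfl⟩
    · intro e he e' he' h
      obtain ⟨m1, rfl⟩ := mem_filter.1 he
      obtain ⟨m2, m3⟩ := mem_filter.1 he'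
      have h' : own e = own e' := congrArg Subtype.val h
      obtain ⟨h1, h2⟩ := hown e m1
      exact h2.eq_of_snd_eq (hP _ h1) (h' ▸ (hown e' m2).2) m3.symm
    · intro i hi
      obtain ⟨e, he, hv, ho⟩ := (mem_filter.1 hi).2
      exact ⟨e, mem_filter.2 ⟨he, hv⟩, Subtype.ext ho⟩
  choose f hf hfd using fun v => exists_disjoint_subsets (O v) hk
  let S : PathSystem P ((v : V) × Fin (#(O v) / k)) k M :=
    { on := fun x => f x.1 x.2
      pos := fun i x => hop E i.1.1 x.1
      card_on := fun x => (hf x.1 x.2).2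
      pos_pos := by
        intro i x hi
        obtain ⟨e, -, he, hv, -⟩ := hO ((hf x.1 x.2).1 hi)
        exact hv ▸ (he.hop_eq (hP _ i.2)).1
      pos_le := by
        intro i x hi
        obtain ⟨e, -, he, hv, -⟩ := hO ((hf x.1 x.2).1 hi)
        exact hv ▸ (he.hop_eq (hP _ i.2)).2.1.trans (hM _ i.2)
      pos_inj := by
        rintro i ⟨u, t⟩ ⟨v, t'⟩ hi hi' h
        obtain ⟨e, -, he, hv, -⟩ := hO ((hf u t).1 hi)
        obtain ⟨e', -, he', hv', -⟩ := hO ((hf v t').1 hi')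
        obtain rfl : u = v := by
          rw [← hv, ← hv', ← (he.hop_eq (hP _ i.2)).2.2.1, ← (he'.hop_eq (hP _ i.2)).2.2.1, hv, hv']
          exact congrArg _ h
        rw [hfd u t t' i hi hi']
      pos_rev := by
        rintro i j ⟨u, t⟩ ⟨v, t'⟩ hij hiu hiv hju hjv hlt
        obtain ⟨d, -, hd, rfl, -⟩ := hO ((hf u t).1 hiu)
        obtain ⟨e, -, he, rfl, ho⟩ := hO ((hf v t').1 hiv)
        obtain ⟨d', -, hd', hdd, -⟩ := hO ((hf _ t).1 hju)
        obtain ⟨e', -, he', hee, ho'⟩ := hO ((hf _ t').1 hjv)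
        by_contra! hc
        change hop E i.1.1 d.2 < hop E i.1.1 e.2 at hlt
        change hop E j.1.1 d.2 ≤ hop E j.1.1 e.2 at hc
        rcases hc.lt_or_eq with hc | hc
        · have := Traverses.eq_of_common (hP _ i.2) (hP _ j.2) hd hd' he he' hdd.symm hee.symm hlt
            (by rwa [hdd, hee])
          exact hij (Subtype.ext (by rw [← ho, ← ho', this]))
        · have h1 := (hd'.hop_eq (hP _ j.2)).2.2.1
          have h2 := (he'.hop_eq (hP _ j.2)).2.2.1
          rw [hdd, hc] at h1
          rw [hee, h1] at h2
          rw [h2] at hlt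
          exact lt_irrefl _ hlt
      pos_triangle := by
        rintro i j j' ⟨v, t⟩ ⟨w, t'⟩ ⟨w', t''⟩ hjv hjw hiw hiw' hjv' hjw' h1 h2 h3
        obtain ⟨a, -, ha, rfl, -⟩ := hO ((hf v t).1 hjv)
        obtain ⟨b, -, hb, rfl, -⟩ := hO ((hf w t').1 hjw)
        obtain ⟨c, -, hc, hcb, -⟩ := hO ((hf _ t').1 hiw)
        obtain ⟨d, -, hd, rfl, -⟩ := hO ((hf w' t'').1 hiw')
        obtain ⟨x, -, hx, hxa, -⟩ := hO ((hf _ t).1 hjv')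
        obtain ⟨y, -, hy, hyd, -⟩ := hO ((hf _ t'').1 hjw')
        have e1 := hop_le_hop_sub (hP _ j.2) ha hb h1
        have e2 := hop_le_hop_sub (hP _ i.2) hc hd (by rw [hcb]; exact h2)
        have e3 := hop_le_hop_sub (hP _ j'.2) hx hy (by rw [hxa, hyd]; exact h3)
        rw [hcb] at e2
        rw [hxa, hyd] at e3
        have e4 := (e1.1.trans e2.1).hop_le
        dsimp only at e1 e2 e3 e4 ⊢
        omega }
  have hS := S.incidence_bound
  rw [Fintype.card_coe] at hS
  refine ⟨_, ?_, ?_, hS⟩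
  · rw [Fintype.card_sigma, hcard, sum_mul]
    refine sum_le_sum fun v _ => ?_
    rw [Fintype.card_fin]
    exact Nat.div_mul_le_self _ _
  · rw [Fintype.card_sigma, hcard, sum_mul, ← card_univ, ← smul_eq_mul, ← sum_const,
      ← sum_add_distrib]
    refine sum_le_sum fun v _ => ?_
    rw [Fintype.card_fin]
    have := Nat.lt_div_mul_add (a := #(O v)) hk
    exact this.le

end CanonEdges

theorem le_of_incidence_bound {n p M E : ℕ} {φ L X : ℝ} (hn : 1 ≤ n) (hp : 1 ≤ p) (hφ : 0 < φ)
    (hpφ : 100 * (p : ℝ) ^ 2 ≤ n * φ ^ 2) (hM : (M : ℝ) ≤ 2 * L) (hX : 0 ≤ X)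
    (hX2 : X ^ 2 * φ ^ 3 = L * p ^ 4)
    (H : ∀ k > 0, ∃ N, N * k ≤ E ∧ E ≤ N * k + n * k ∧
      (k < 8 ∨ k ^ 3 < 672 * p ∨ N * k ^ 2 ≤ 2688 * p ^ 2 ∨
        N ^ 2 * k ^ 5 ≤ 15000000 * (p ^ 4 * M))) :
    (E : ℝ) ≤ 20000 * (X + n * p / φ ^ 2 + n * φ) := by
  have hn' : (1 : ℝ) ≤ n := by exact_mod_cast hn
  have hp' : (1 : ℝ) ≤ p := by exact_mod_cast hp
  have hA : (0 : ℝ) ≤ n * p / φ ^ 2 := by positivity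
  have hB : (0 : ℝ) ≤ n * φ := by positivity
  obtain ⟨k, hk⟩ : ∃ k, k = E / (2 * n) := ⟨_, rfl⟩
  have k1 : 2 * n * k ≤ E := hk ▸ Nat.mul_div_le _ _
  have k2 : E < 2 * n * (k + 1) := hk ▸ Nat.lt_mul_div_succ _ (by omega)
  clear hk
  have k2' : (E : ℝ) < 2 * n * (k + 1) := by exact_mod_cast k2
  rcases lt_or_ge k 8 with hk8 | hk8
  · have h1 : (E : ℝ) ≤ 16 * n := by
      have : (k : ℝ) + 1 ≤ 8 := by exact_mod_cast hk8
      nlinarith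
    have h2 : (n : ℝ) ≤ n * p / φ ^ 2 + n * φ := by
      rcases le_total 1 φ with h | h
      · nlinarith
      · have : (n : ℝ) ≤ n * p / φ ^ 2 := by
          rw [le_div_iff₀ (by positivity)]
          have : φ ^ 2 ≤ 1 := pow_le_one₀ hφ.le h
          gcongr
          linarith
        linarith
    linarith
  obtain ⟨N, N1, N2, N3⟩ := H k (by omega)
  have hk8' : (8 : ℝ) ≤ k := by exact_mod_cast hk8
  have hk0 : (0 : ℝ) < k := by linarith
  have hnN : n ≤ N := by
    have : n * k ≤ N * k := by linarith
    exact Nat.le_of_mul_le_mul_right this (by omega)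
  have E1 : (E : ℝ) ≤ 4 * (n * k) := by nlinarith
  have E2 : (E : ℝ) ≤ 2 * (N * k) := by
    have : n * k ≤ N * k := Nat.mul_le_mul_right _ hnN
    have : E ≤ 2 * (N * k) := by omega
    exact_mod_cast this
  rcases le_total (k : ℝ) φ with hkφ | hkφ
  · have : (n : ℝ) * k ≤ n * φ := by gcongr
    linarith
  rcases N3 with h | h | h | h
  · omega
  · have h' : (k : ℝ) ^ 3 ≤ 672 * p := by exact_mod_cast h.le
    have h1 : (k : ℝ) * φ ^ 2 ≤ k * k ^ 2 := by gcongr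
    have h2 : (n : ℝ) * k ≤ 672 * (n * p / φ ^ 2) := by
      rw [← mul_div_assoc, le_div_iff₀ (by positivity)]
      have : (n : ℝ) * (k * φ ^ 2) ≤ n * (672 * p) :=
      mul_le_mul_of_nonneg_left (by linarith) (by positivity)
      linarith
    linarith
  · have h' : (N : ℝ) * k ^ 2 ≤ 2688 * p ^ 2 := by exact_mod_cast h
    have h1 : (n : ℝ) * k ^ 2 ≤ N * k ^ 2 := by gcongr
    have h2 : (n : ℝ) * k ^ 2 ≤ n * (6 * φ) ^ 2 := by
      have : (0 : ℝ) ≤ n * φ ^ 2 := by positivity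
      linarith
    have h3 := le_of_mul_le_mul_left h2 (by linarith)
    have h4 := (pow_le_pow_iff_left₀ hk0.le (by positivity) two_ne_zero).1 h3
    have : (n : ℝ) * k ≤ n * (6 * φ) := by gcongr
    linarith
  · have h' : (N : ℝ) ^ 2 * k ^ 5 ≤ 15000000 * (p ^ 4 * M) := by exact_mod_cast h
    have h1 : (N : ℝ) ^ 2 * k ^ 2 * φ ^ 3 ≤ N ^ 2 * k ^ 2 * k ^ 3 := by gcongr
    have h2 : (p : ℝ) ^ 4 * M ≤ p ^ 4 * (2 * L) := by gcongr
    have h3 : φ ^ 3 * (2 * (N * k)) ^ 2 ≤ φ ^ 3 * (11000 * X) ^ 2 := by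
      have : 0 ≤ X ^ 2 * φ ^ 3 := by positivity
      linarith
    have h4 := le_of_mul_le_mul_left h3 (by positivity)
    have h5 := (pow_le_pow_iff_left₀ (by positivity) (by positivity) two_ne_zero).1 h4
    linarith

/-- exact distance preservers of size
`O(polylog(n)·(L^{1/2} p²/φ^{3/2} + np/φ² + nφ))` in directed unweighted graphs whose
demand-pair distances all lie in `[L/2, 2L]`. -/
theorem bucketed_preserver_upper_bound :
    ∃ C : ℝ, 1 ≤ C ∧
      ∀ (V : Type) [Fintype V] (G : WDigraph V), G.Unweighted →
      ∀ P : Finset (V × V), (∀ q ∈ P, G.Reachable q.1 q.2) →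
      ∀ L : ℝ, 1 ≤ L →
        (∀ q ∈ P, L / 2 ≤ G.dist q.1 q.2 ∧ G.dist q.1 q.2 ≤ 2 * L) →
      ∀ φ : ℝ, 10 * (P.card : ℝ) / (Fintype.card V : ℝ) ^ ((1 : ℝ) / 2) ≤ φ →
        ∃ F : Finset (V × V), G.IsExactPreserver F P ∧
          (F.card : ℝ) ≤
            C * Real.log ((Fintype.card V : ℝ) + 1) ^ (C : ℝ) *
              (L ^ ((1 : ℝ) / 2) * (P.card : ℝ) ^ 2 / φ ^ ((3 : ℝ) / 2) +
                (Fintype.card V : ℝ) * (P.card : ℝ) / φ ^ 2 +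
                (Fintype.card V : ℝ) * φ) := by
  refine ⟨20000, by norm_num, ?_⟩
  intro V _ G hG P hreach L hL hdist φ hφ
  let _ : LinearOrder V := LinearOrder.lift' (Fintype.equivFin V) (Fintype.equivFin V).injective
  have hP : ∀ q ∈ P, HasWalk G.Edge (hop G.Edge q.1 q.2) q.1 q.2 := by
    intro q hq
    obtain ⟨l, hl⟩ := hreach q hq
    obtain ⟨n, hn, -⟩ := hl.hasWalk
    exact hn.hop_spec
  have hdist_eq : ∀ q ∈ P, G.dist q.1 q.2 = hop G.Edge q.1 q.2 := fun q hq =>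
    hG.distOn_eq subset_rfl (hP q hq) fun m hm => hm.hop_le
  have hsub : canonEdges G.Edge P ⊆ G.Edge := by
    intro e he
    obtain ⟨q, hq, a, ha, rfl⟩ := mem_canonEdges.1 he
    exact (mem_closer.1 (canon_succ_mem (hP q hq) ha)).1
  refine ⟨canonEdges G.Edge P, ⟨hsub, fun q hq => ?_⟩, ?_⟩
  · have hw : HasWalk (canonEdges G.Edge P) (hop G.Edge q.1 q.2) q.1 q.2 := by
      have := hasWalk_canon (E := G.Edge) (F := canonEdges G.Edge P) (s := q.1) (t := q.2)
        (fun a ha => mem_canonEdges.2 ⟨q, hq, a, ha, rfl⟩) (a := 0)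
        (c := hop G.Edge q.1 q.2) (by omega)
      rwa [Nat.zero_add, canon_last (hP q hq)] at this
    constructor
    · obtain ⟨l, hl, -⟩ := hw.exists_list
      exact ⟨l, hl⟩
    · rw [hdist_eq q hq, hG.distOn_eq hsub hw fun m hm => (hm.mono hsub).hop_le]
  rcases P.eq_empty_or_nonempty with rfl | ⟨q, hq⟩
  · have hφ0 : 0 ≤ φ := by simpa using hφ
    have hlog : 0 ≤ Real.log ((Fintype.card V : ℝ) + 1) :=
      Real.log_nonneg (by linarith [Nat.cast_nonneg (α := ℝ) (Fintype.card V)])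
    simp only [canonEdges, biUnion_empty, card_empty, Nat.cast_zero]
    positivity
  have hp : 1 ≤ #P := card_pos.2 ⟨q, hq⟩
  have hn : 2 ≤ Fintype.card V := by
    have hne : q.1 ≠ q.2 := by
      intro h
      have h0 : HasWalk G.Edge 0 q.1 q.2 := h
      have h1 := (hdist q hq).1
      rw [hdist_eq q hq, Nat.le_zero.1 h0.hop_le] at h1
      norm_num at h1
      linarith
    exact Fintype.one_lt_card_iff.2 ⟨_, _, hne⟩
  have hn' : (2 : ℝ) ≤ Fintype.card V := by exact_mod_cast hn
  have hp' : (1 : ℝ) ≤ #P := by exact_mod_cast hp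
  have hroot : (0 : ℝ) < (Fintype.card V : ℝ) ^ ((1 : ℝ) / 2) := by positivity
  have hφ0 : 0 < φ := lt_of_lt_of_le (by positivity) hφ
  have hpφ : 100 * (#P : ℝ) ^ 2 ≤ Fintype.card V * φ ^ 2 := by
    rw [div_le_iff₀ hroot] at hφ
    have h1 := pow_le_pow_left₀ (by positivity) hφ 2
    have h2 : ((Fintype.card V : ℝ) ^ ((1 : ℝ) / 2)) ^ 2 = Fintype.card V := by
      rw [← Real.sqrt_eq_rpow, Real.sq_sqrt (by positivity)]
    rw [mul_pow φ, h2] at h1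
    linarith
  have hL0 : 0 ≤ L := by linarith
  have hX2 : (L ^ ((1 : ℝ) / 2) * (#P : ℝ) ^ 2 / φ ^ ((3 : ℝ) / 2)) ^ 2 * φ ^ 3 =
      L * (#P : ℝ) ^ 4 := by
    have h1 : (L ^ ((1 : ℝ) / 2)) ^ 2 = L := by
      rw [← Real.sqrt_eq_rpow, Real.sq_sqrt hL0]
    have h2 : (φ ^ ((3 : ℝ) / 2)) ^ 2 = φ ^ 3 := by
      rw [← Real.rpow_natCast, ← Real.rpow_mul hφ0.le, ← Real.rpow_natCast]
      norm_num
    rw [div_pow, mul_pow, h1, h2]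
    field_simp
  have hM : ∀ q ∈ P, hop G.Edge q.1 q.2 ≤ ⌊2 * L⌋₊ := by
    intro q hq
    apply Nat.le_floor
    rw [← hdist_eq q hq]
    exact (hdist q hq).2
  have hbound := le_of_incidence_bound (by omega : 1 ≤ Fintype.card V) hp hφ0 hpφ
    (Nat.floor_le (by positivity : 0 ≤ 2 * L)) (by positivity) hX2
    (fun k hk => card_canonEdges hP hM hk)
  have hlog : 1 ≤ Real.log ((Fintype.card V : ℝ) + 1) ^ (20000 : ℝ) := by
    apply Real.one_le_rpow _ (by norm_num)
    rw [Real.le_log_iff_exp_le (by positivity)]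
    linarith [Real.exp_one_lt_d9]
  refine hbound.trans ?_
  rw [mul_assoc]
  gcongr
  exact le_mul_of_one_le_left (by positivity) hlog
end
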